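/- arXiv:2405.04117 — 3 statements merged into one kernel-verified Lean document; each statement's English description precedes it below -/
import Mathlib

section
/- For every integer d ≥ 3 and every natural number N, there exists a connected d-regular simple graph on more than N vertices whose automorphism group is trivial. -/
open scoped Classical

/-- A *nut graph*: a finite simple graph on at least 2 vertices whose real adjacency
matrix has nullity (kernel dimension) exactly 1 and such that every nonzero vector in
the kernel of the adjacency matrix has all entries nonzero. -/
def SimpleGraph.IsNut {V : Type*} [Fintype V] (G : SimpleGraph V) : Prop :=
  2 ≤ Fintype.card V ∧
  Module.finrank ℝ (LinearMap.ker (Matrix.mulVecLin (G.adjMatrix ℝ))) = 1 ∧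
  ∀ x : V → ℝ, Matrix.mulVecLin (G.adjMatrix ℝ) x = 0 → x ≠ 0 → ∀ v : V, x v ≠ 0

/-- The automorphism group of a simple graph, realised as the subgroup of the
permutations of the vertex set that preserve adjacency (and non-adjacency). -/
def SimpleGraph.autGroup {V : Type*} (G : SimpleGraph V) : Subgroup (Equiv.Perm V) where
  carrier := { σ | ∀ u v : V, G.Adj (σ u) (σ v) ↔ G.Adj u v }
  mul_mem' := by
    intro σ τ hσ hτ u v
    simpa [hσ (τ u) (τ v)] using hτ u v
  one_mem' := by intro u v; rfl
  inv_mem' := by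
    intro σ hσ u v
    have := hσ (σ⁻¹ u) (σ⁻¹ v)
    simpa using this.symm

namespace AsymReg

/-- Connected, `d`-regular and asymmetric. -/
def Good {V : Type} (G : SimpleGraph V) (d : ℕ) : Prop :=
  G.Connected ∧ (∀ v, (G.neighborSet v).ncard = d) ∧
  ∀ σ : Equiv.Perm V, (∀ u v, G.Adj (σ u) (σ v) ↔ G.Adj u v) → ∀ v, σ v = v

/-! ### Inflation: replace every vertex by a clique -/

/-- The inflation of a graph: vertices are darts. -/
def infl {V : Type} (G : SimpleGraph V) : SimpleGraph G.Dart where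
  Adj x y := x ≠ y ∧ (x.fst = y.fst ∨ y = x.symm)
  symm := ⟨by
    rintro x y ⟨h, h'⟩
    refine ⟨h.symm, h'.imp Eq.symm ?_⟩
    rintro rfl
    simp⟩
  loopless := ⟨by rintro x ⟨h, _⟩; exact h rfl⟩

theorem infl_adj {V : Type} (G : SimpleGraph V) (x y : G.Dart) :
    (infl G).Adj x y ↔ x ≠ y ∧ (x.fst = y.fst ∨ y = x.symm) := Iff.rfl

theorem ne_symm {V : Type} {G : SimpleGraph V} (x : G.Dart) : x ≠ x.symm := by
  intro h
  have := congrArg (fun y : G.Dart => y.fst) h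
  exact x.adj.ne this

theorem dart_ext {V : Type} {G : SimpleGraph V} {x y : G.Dart} (h1 : x.fst = y.fst)
    (h2 : x.snd = y.snd) : x = y := by
  apply SimpleGraph.Dart.ext
  exact Prod.ext h1 h2

theorem ncard_fst {V : Type} [Fintype V] (G : SimpleGraph V) (u : V) :
    {y : G.Dart | y.fst = u}.ncard = (G.neighborSet u).ncard := by
  rw [← Set.InjOn.ncard_image (f := fun y : G.Dart => y.snd) (s := {y : G.Dart | y.fst = u})]
  · congr 1
    ext w
    constructor
    · rintro ⟨y, hy, rfl⟩
      have := y.adj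
      simp only [Set.mem_ofPred_eq] at hy
      rw [hy] at this
      exact this
    · intro hw
      exact ⟨⟨(u, w), hw⟩, rfl, rfl⟩
  · intro x hx y hy h
    exact dart_ext (hx.trans hy.symm) h

theorem infl_degree {V : Type} [Fintype V] (G : SimpleGraph V) (x : G.Dart) :
    ((infl G).neighborSet x).ncard = (G.neighborSet x.fst).ncard := by
  have : (infl G).neighborSet x = insert x.symm ({y : G.Dart | y.fst = x.fst} \ {x}) := by
    ext y
    simp only [SimpleGraph.mem_neighborSet, infl_adj, Set.mem_insert_iff, Set.mem_sdiff,
      Set.mem_ofPred_eq, Set.mem_singleton_iff]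
    constructor
    · rintro ⟨h, h' | h'⟩
      · exact Or.inr ⟨h'.symm, h.symm⟩
      · exact Or.inl h'
    · rintro (h | ⟨h, h'⟩)
      · exact ⟨fun e => ne_symm x (e.trans h), Or.inr h⟩
      · exact ⟨fun e => h' e.symm, Or.inl h.symm⟩
  rw [this, Set.ncard_insert_of_notMem, Set.ncard_sdiff_singleton_add_one, ncard_fst]
  · rfl
  · rintro ⟨h, _⟩
    exact x.adj.ne h.symm

theorem infl_connected {V : Type} (G : SimpleGraph V) (h : G.Connected)
    (hn : Nonempty G.Dart) : (infl G).Connected := by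
  have same : ∀ x y : G.Dart, x.fst = y.fst → (infl G).Reachable x y := by
    intro x y hxy
    by_cases e : x = y
    · subst e; exact SimpleGraph.Reachable.refl _
    · exact SimpleGraph.Adj.reachable ⟨e, Or.inl hxy⟩
  have main : ∀ u v : V, G.Walk u v → ∀ x y : G.Dart, x.fst = u → y.fst = v →
      (infl G).Reachable x y := by
    intro u v p
    induction p with
    | nil => intro x y hx hy; exact same x y (hx.trans hy.symm)
    | @cons a b c hab p ih =>
      intro x y hx hy
      let z : G.Dart := ⟨(a, b), hab⟩
      have h1 : (infl G).Reachable x z := same x z hx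
      have h2 : (infl G).Reachable z z.symm :=
        SimpleGraph.Adj.reachable ⟨ne_symm z, Or.inr rfl⟩
      exact (h1.trans h2).trans (ih z.symm y rfl hy)
  have := hn
  refine ⟨fun x y => ?_⟩
  obtain ⟨p⟩ := h.preconnected x.fst y.fst
  exact main _ _ p x y rfl rfl

theorem infl_good {V : Type} [Fintype V] (G : SimpleGraph V) (d : ℕ) (hd : 3 ≤ d)
    (h : Good G d) : Good (infl G) d := by
  obtain ⟨hc, hr, ha⟩ := h
  have exd : ∀ u, ∃ x : G.Dart, x.fst = u := by
    intro u
    have : (G.neighborSet u).Nonempty := by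
      apply Set.nonempty_of_ncard_ne_zero
      rw [hr]; omega
    obtain ⟨w, hw⟩ := this
    exact ⟨⟨(u, w), hw⟩, rfl⟩
  have exthird : ∀ x y : G.Dart, x.fst = y.fst → ∃ z : G.Dart, z.fst = x.fst ∧ z ≠ x ∧ z ≠ y := by
    intro x y _
    have h1 : ({y : G.Dart | y.fst = x.fst} \ {x, y}).Nonempty := by
      apply Set.nonempty_of_ncard_ne_zero
      have h2 := Set.le_ncard_sdiff {x, y} {y : G.Dart | y.fst = x.fst} (Set.toFinite _)
      rw [ncard_fst, hr] at h2
      have h3 := Set.ncard_insert_le x {y}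
      rw [Set.ncard_singleton] at h3
      omega
    obtain ⟨z, hz, hz'⟩ := h1
    simp only [Set.mem_insert_iff, Set.mem_singleton_iff, not_or] at hz'
    exact ⟨z, hz, hz'.1, hz'.2⟩
  have := hc.nonempty
  have hn : Nonempty G.Dart := ⟨(exd (Classical.arbitrary V)).choose⟩
  refine ⟨infl_connected G hc hn, fun x => by rw [infl_degree, hr], ?_⟩
  -- characterisation of clique edges
  have char : ∀ x y : G.Dart, x.fst = y.fst ↔
      x = y ∨ ((infl G).Adj x y ∧ ∃ z, (infl G).Adj x z ∧ (infl G).Adj y z) := by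
    intro x y
    constructor
    · intro hxy
      by_cases e : x = y
      · exact Or.inl e
      · obtain ⟨z, hz, hzx, hzy⟩ := exthird x y hxy
        exact Or.inr ⟨⟨e, Or.inl hxy⟩, z, ⟨hzx.symm, Or.inl hz.symm⟩,
          ⟨hzy.symm, Or.inl (hxy.symm.trans hz.symm)⟩⟩
    · rintro (h | ⟨⟨e, h | h⟩, z, ⟨h1, h1'⟩, ⟨h2, h2'⟩⟩)
      · rw [h]
      · exact h
      · exfalso
        subst h
        rcases h1' with h1' | h1'
        · rcases h2' with h2' | h2'
          · exact x.adj.ne (h1'.trans h2'.symm)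
          · exact h1 (by rw [h2']; simp)
        · exact h2 h1'.symm
  have key : ∀ σ : Equiv.Perm G.Dart, (∀ u v, (infl G).Adj (σ u) (σ v) ↔ (infl G).Adj u v) →
      (∀ x y : G.Dart, (σ x).fst = (σ y).fst ↔ x.fst = y.fst) ∧
      (∀ x : G.Dart, σ x.symm = (σ x).symm) := by
    intro σ hσ
    have h1 : ∀ x y : G.Dart, (σ x).fst = (σ y).fst ↔ x.fst = y.fst := by
      intro x y
      rw [char, char x y, hσ, σ.injective.eq_iff]
      constructor
      · rintro (h | ⟨h, z, hz⟩)
        · exact Or.inl h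
        · refine Or.inr ⟨h, σ.symm z, ?_, ?_⟩
          · rw [← hσ]; simpa using hz.1
          · rw [← hσ]; simpa using hz.2
      · rintro (h | ⟨h, z, hz⟩)
        · exact Or.inl h
        · exact Or.inr ⟨h, σ z, (hσ _ _).2 hz.1, (hσ _ _).2 hz.2⟩
    refine ⟨h1, fun x => ?_⟩
    have h2 : (infl G).Adj (σ x) (σ x.symm) := (hσ _ _).2 ⟨ne_symm x, Or.inr rfl⟩
    rcases h2.2 with h3 | h3
    · exact absurd ((h1 _ _).1 h3) x.adj.ne
    · exact h3
  intro σ hσ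
  obtain ⟨k1, k2⟩ := key σ hσ
  choose D hD using exd
  let τ : V → V := fun u => (σ (D u)).fst
  have hτ : ∀ x : G.Dart, (σ x).fst = τ x.fst := by
    intro x
    exact (k1 _ _).2 (hD x.fst).symm
  have hτ2 : ∀ x : G.Dart, (σ x).snd = τ x.snd := by
    intro x
    have := hτ x.symm
    rw [k2] at this
    exact this
  have inj : Function.Injective τ := by
    intro u v huv
    have := (k1 _ _).1 huv
    rwa [hD, hD] at this
  let T : Equiv.Perm V := Equiv.ofBijective τ (Finite.injective_iff_bijective.1 inj)
  have hT : ∀ v, τ v = v := by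
    refine ha T ?_
    intro u v
    change G.Adj (τ u) (τ v) ↔ G.Adj u v
    constructor
    · intro h
      obtain ⟨x, hx⟩ := σ.surjective ⟨(τ u, τ v), h⟩
      have e1 : τ x.fst = τ u := by rw [← hτ, hx]
      have e2 : τ x.snd = τ v := by rw [← hτ2, hx]
      have := x.adj
      rwa [inj e1, inj e2] at this
    · intro h
      have := (σ ⟨(u, v), h⟩).adj
      rwa [hτ, hτ2] at this
  intro x
  exact dart_ext ((hτ x).trans (hT _)) ((hτ2 x).trans (hT _))

theorem infl_card {V : Type} [Fintype V] (G : SimpleGraph V) (d : ℕ) (hd : 3 ≤ d)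
    (h : Good G d) : Fintype.card V < Fintype.card G.Dart := by
  have h1 := G.dart_card_eq_sum_degrees
  have h2 : ∀ v, G.degree v = d := by
    intro v
    rw [← h.2.1 v, ← Nat.card_coe_set_eq, Nat.card_eq_fintype_card,
      SimpleGraph.card_neighborSet_eq_degree]
  simp only [h2, Finset.sum_const, Finset.card_univ, smul_eq_mul] at h1
  have := h.1.nonempty
  have h3 : 0 < Fintype.card V := Fintype.card_pos
  have h4 : Fintype.card V * 3 ≤ Fintype.card V * d := Nat.mul_le_mul_left _ hd
  have h5 : Fintype.card G.Dart = Fintype.card V * d := by convert h1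
  omega

theorem grow (d : ℕ) (hd : 3 ≤ d)
    (h : ∃ (V : Type) (_ : Fintype V) (G : SimpleGraph V), Good G d) (N : ℕ) :
    ∃ (V : Type) (_ : Fintype V) (G : SimpleGraph V), Good G d ∧ N < Fintype.card V := by
  induction N with
  | zero =>
    obtain ⟨V, i, G, hG⟩ := h
    have := hG.1.nonempty
    exact ⟨V, i, G, hG, Fintype.card_pos⟩
  | succ N ih =>
    obtain ⟨V, i, G, hG, hN⟩ := ih
    refine ⟨G.Dart, inferInstance, infl G, infl_good G d hd hG, ?_⟩
    have := infl_card G d hd hG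
    omega

theorem transfer (d N : ℕ)
    (h : ∃ (V : Type) (_ : Fintype V) (G : SimpleGraph V), Good G d ∧ N < Fintype.card V) :
    ∃ (n : ℕ) (G : SimpleGraph (Fin n)),
      G.Connected ∧ G.IsRegularOfDegree d ∧ N < n ∧ G.autGroup = ⊥ := by
  obtain ⟨V, i, G, ⟨hc, hr, ha⟩, hN⟩ := h
  let e : Fin (Fintype.card V) ≃ V := (Fintype.equivFin V).symm
  let I : G.comap e ≃g G := SimpleGraph.Iso.comap e G
  refine ⟨Fintype.card V, G.comap e, I.connected_iff.2 hc, ?_, hN, ?_⟩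
  · intro v
    rw [← hr (e v), ← SimpleGraph.card_neighborSet_eq_degree, ← Nat.card_eq_fintype_card]
    exact Nat.card_congr (I.mapNeighborSet v)
  · rw [eq_bot_iff]
    intro σ hσ
    rw [Subgroup.mem_bot]
    have hσ' : ∀ u v, (G.comap e).Adj (σ u) (σ v) ↔ (G.comap e).Adj u v := hσ
    have := ha ((e.symm.trans σ).trans e) (by
      intro u v
      have := hσ' (e.symm u) (e.symm v)
      simpa using this)
    ext v
    have h2 := this (e v)
    simp only [Equiv.trans_apply, Equiv.symm_apply_apply] at h2
    rw [e.injective h2]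
    rfl

/-! ### Small graphs, via colour refinement -/

/-- Adjacency from bit masks. -/
def bm {n : ℕ} (r : Fin n → ℕ) (u v : Fin n) : Bool :=
  (r u).testBit v

/-- The graph with boolean adjacency `b`. -/
def bg {n : ℕ} (b : Fin n → Fin n → Bool) (h : ∀ u v, b u v = b v u) (h' : ∀ u, b u u = false) :
    SimpleGraph (Fin n) where
  Adj u v := b u v = true
  symm := ⟨fun u v e => (h v u).trans e⟩
  loopless := ⟨fun u e => by rw [h' u] at e; exact absurd e (by decide)⟩

/-- A vertex function invariant under all automorphisms. -/
def Inv {n : ℕ} (b : Fin n → Fin n → Bool) (f : Fin n → ℕ) : Prop :=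
  ∀ σ : Equiv.Perm (Fin n), (∀ u v, b (σ u) (σ v) = b u v) → ∀ v, f (σ v) = f v

theorem inv_tri {n : ℕ} (b : Fin n → Fin n → Bool) (f : Fin n → ℕ)
    (h : ∀ v, f v = ∑ u, ∑ w, bif (b v u && b v w && b u w) then 1 else 0) : Inv b f := by
  intro σ hσ v
  rw [h, h]
  rw [← Equiv.sum_comp σ]
  refine Finset.sum_congr rfl fun u _ => ?_
  rw [← Equiv.sum_comp σ]
  refine Finset.sum_congr rfl fun w _ => ?_
  rw [hσ, hσ, hσ]

theorem inv_step {n : ℕ} (b : Fin n → Fin n → Bool) (f g : Fin n → ℕ) (hf : Inv b f)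
    (h : ∀ v, g v = f v + ∑ u, bif b v u then f u ^ 2 else 0) : Inv b g := by
  intro σ hσ v
  rw [h, h, ← Equiv.sum_comp σ, hf σ hσ]
  congr 1
  refine Finset.sum_congr rfl fun u _ => ?_
  rw [hσ, hf σ hσ]

theorem bg_good {n d : ℕ} (b : Fin (n + 1) → Fin (n + 1) → Bool) (h : ∀ u v, b u v = b v u)
    (h' : ∀ u, b u u = false) (hd : ∀ v, (Finset.univ.filter fun u => b v u = true).card = d)
    (hp : ∀ v, v = 0 ∨ ∃ u, u < v ∧ b v u = true)
    (f : Fin (n + 1) → ℕ) (hf : Inv b f) (hi : ∀ u v, f u = f v → u = v) :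
    ∃ (V : Type) (_ : Fintype V) (G : SimpleGraph V), Good G d := by
  refine ⟨Fin (n + 1), inferInstance, bg b h h', ?_, ?_, ?_⟩
  · have : ∀ k : ℕ, ∀ v : Fin (n + 1), v.val = k → (bg b h h').Reachable v 0 := by
      intro k
      induction k using Nat.strong_induction_on with
      | _ k ih =>
        intro v hv
        rcases hp v with rfl | ⟨u, hu, hb⟩
        · exact SimpleGraph.Reachable.refl _
        · have h1 : (bg b h h').Adj v u := hb
          exact h1.reachable.trans (ih u.val (by rw [← hv]; exact hu) u rfl)
    exact ⟨fun x y => (this _ x rfl).trans (this _ y rfl).symm⟩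
  · intro v
    rw [← hd v, ← Set.ncard_coe_finset]
    congr 1
    ext u
    simp [bg]
  · intro σ hσ v
    apply hi
    apply hf
    intro u v
    have : b (σ u) (σ v) = true ↔ b u v = true := hσ u v
    exact Bool.eq_iff_iff.2 this

theorem base3 : ∃ (V : Type) (_ : Fintype V) (G : SimpleGraph V), Good G 3 := by
  let b : Fin 16 → Fin 16 → Bool := bm ![14, 49, 73, 133, 770, 3074, 12292, 20488, 16912, 2320,
    49184, 33312, 8384, 36928, 1408, 11264]
  refine bg_good (n := 15) b (by decide +kernel) (by decide +kernel) (by decide +kernel)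
    (by decide +kernel) ![348634, 218584, 442310, 355546, 145690, 58768, 409094, 302248, 154602,
    140778, 49056, 71996, 322330, 319722, 102444, 119228] ?_ (by decide +kernel)
  refine inv_step b ![370, 208, 410, 370, 274, 80, 410, 224, 226, 226, 32, 120, 370, 322, 168, 120]
    _ ?_ (by decide +kernel)
  refine inv_step b ![10, 8, 14, 10, 10, 0, 14, 8, 10, 10, 0, 4, 10, 10, 4, 4] _ ?_
    (by decide +kernel)
  refine inv_step b ![2, 0, 2, 2, 2, 0, 2, 0, 2, 2, 0, 0, 2, 2, 0, 0] _ ?_ (by decide +kernel)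
  exact inv_tri b _ (by decide +kernel)

theorem base4 : ∃ (V : Type) (_ : Fintype V) (G : SimpleGraph V), Good G 4 := by
  let b : Fin 11 → Fin 11 → Bool :=
    bm ![30, 101, 163, 225, 1793, 1038, 778, 1548, 1616, 464, 432]
  refine bg_good (n := 10) b (by decide +kernel) (by decide +kernel) (by decide +kernel)
    (by decide +kernel) ![50, 32, 28, 12, 64, 38, 70, 36, 46, 60, 58] ?_ (by decide +kernel)
  refine inv_step b ![2, 4, 4, 0, 4, 2, 2, 0, 6, 4, 2] _ ?_ (by decide +kernel)
  exact inv_tri b _ (by decide +kernel)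

theorem base5 : ∃ (V : Type) (_ : Fintype V) (G : SimpleGraph V), Good G 5 := by
  let b : Fin 10 → Fin 10 → Bool := bm ![62, 229, 339, 929, 837, 779, 662, 842, 188, 248]
  refine bg_good (n := 9) b (by decide +kernel) (by decide +kernel) (by decide +kernel)
    (by decide +kernel) ![617128, 659880, 751082, 729986, 726976, 729944, 711378, 703936, 595510,
    615224] ?_ (by decide +kernel)
  refine inv_step b ![400, 400, 338, 302, 372, 336, 366, 372, 398, 400] _ ?_ (by decide +kernel)
  refine inv_step b ![8, 8, 10, 10, 8, 8, 10, 8, 6, 8] _ ?_ (by decide +kernel)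
  exact inv_tri b _ (by decide +kernel)

theorem base6 : ∃ (V : Type) (_ : Fintype V) (G : SimpleGraph V), Good G 6 := by
  let b : Fin 11 → Fin 11 → Bool :=
    bm ![126, 429, 867, 1619, 489, 1175, 1565, 1842, 1686, 1484, 1000]
  refine bg_good (n := 10) b (by decide +kernel) (by decide +kernel) (by decide +kernel)
    (by decide +kernel) ![1202, 1378, 1438, 1386, 1436, 1326, 1328, 1200, 1258, 1312, 1370] ?_
    (by decide +kernel)
  refine inv_step b ![18, 14, 14, 14, 12, 14, 16, 16, 14, 16, 14] _ ?_ (by decide +kernel)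
  exact inv_tri b _ (by decide +kernel)

/-! ### Dense graphs: the complement of a rigid 4-regular graph on `m + 5` vertices -/

/-- The upward edges of the sparse graph: a squared path on `0, ..., m-1`, and a gadget. -/
def E (m u v : ℕ) : Prop :=
  (v < m ∧ u < v ∧ v ≤ u + 2) ∨ (u = 0 ∧ v = m - 2) ∨ (u = 0 ∧ v = m + 2) ∨ (u = 1 ∧ v = m) ∨
  (u = m - 1 ∧ v = m + 1) ∨ (u = m - 1 ∧ v = m + 4) ∨ (u = m ∧ v = m + 1) ∨
  (u = m ∧ v = m + 2) ∨ (u = m ∧ v = m + 3) ∨ (u = m + 1 ∧ v = m + 3) ∨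
  (u = m + 1 ∧ v = m + 4) ∨ (u = m + 2 ∧ v = m + 3) ∨ (u = m + 2 ∧ v = m + 4) ∨
  (u = m + 3 ∧ v = m + 4)

/-- Adjacency of the sparse graph. -/
def A (m u v : ℕ) : Prop := E m u v ∨ E m v u

theorem A_symm {m u v : ℕ} (h : A m u v) : A m v u := Or.symm h

theorem A_p {m u v : ℕ} (h1 : v < m) (h2 : u < v) (h3 : v ≤ u + 2) : A m u v :=
  Or.inl (Or.inl ⟨h1, h2, h3⟩)

theorem nb0 (m : ℕ) (hm : 7 ≤ m) (w : ℕ) :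
    A m 0 w ↔ (w = 1 ∨ w = 2 ∨ w = m - 2 ∨ w = m + 2) := by
  constructor
  · unfold A E
    rintro ((h | h | h | h | h | h | h | h | h | h | h | h | h | h) |
      (h | h | h | h | h | h | h | h | h | h | h | h | h | h)) <;> omega
  · rintro (h | h | h | h) <;> rw [h] <;>
      first
      | exact A_p (by omega) (by omega) (by omega)
      | exact A_symm (A_p (by omega) (by omega) (by omega))
      | (unfold A E; simp)

theorem nb1 (m : ℕ) (hm : 7 ≤ m) (w : ℕ) :
    A m 1 w ↔ (w = 0 ∨ w = 2 ∨ w = 3 ∨ w = m) := by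
  constructor
  · unfold A E
    rintro ((h | h | h | h | h | h | h | h | h | h | h | h | h | h) |
      (h | h | h | h | h | h | h | h | h | h | h | h | h | h)) <;> omega
  · rintro (h | h | h | h) <;> rw [h] <;>
      first
      | exact A_p (by omega) (by omega) (by omega)
      | exact A_symm (A_p (by omega) (by omega) (by omega))
      | (unfold A E; simp)

theorem nbm2 (m : ℕ) (hm : 7 ≤ m) (w : ℕ) :
    A m (m - 2) w ↔ (w = 0 ∨ w = m - 4 ∨ w = m - 3 ∨ w = m - 1) := by
  constructor
  · unfold A E
    rintro ((h | h | h | h | h | h | h | h | h | h | h | h | h | h) |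
      (h | h | h | h | h | h | h | h | h | h | h | h | h | h)) <;> omega
  · rintro (h | h | h | h) <;> rw [h] <;>
      first
      | exact A_p (by omega) (by omega) (by omega)
      | exact A_symm (A_p (by omega) (by omega) (by omega))
      | (unfold A E; simp)

theorem nbm1 (m : ℕ) (hm : 7 ≤ m) (w : ℕ) :
    A m (m - 1) w ↔ (w = m - 3 ∨ w = m - 2 ∨ w = m + 1 ∨ w = m + 4) := by
  constructor
  · unfold A E
    rintro ((h | h | h | h | h | h | h | h | h | h | h | h | h | h) |
      (h | h | h | h | h | h | h | h | h | h | h | h | h | h)) <;> omega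
  · rintro (h | h | h | h) <;> rw [h] <;>
      first
      | exact A_p (by omega) (by omega) (by omega)
      | exact A_symm (A_p (by omega) (by omega) (by omega))
      | (unfold A E; simp)

theorem nbg0 (m : ℕ) (hm : 7 ≤ m) (w : ℕ) :
    A m m w ↔ (w = 1 ∨ w = m + 1 ∨ w = m + 2 ∨ w = m + 3) := by
  constructor
  · unfold A E
    rintro ((h | h | h | h | h | h | h | h | h | h | h | h | h | h) |
      (h | h | h | h | h | h | h | h | h | h | h | h | h | h)) <;> omega
  · rintro (h | h | h | h) <;> rw [h] <;>
      first
      | exact A_p (by omega) (by omega) (by omega)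
      | exact A_symm (A_p (by omega) (by omega) (by omega))
      | (unfold A E; simp)

theorem nbg1 (m : ℕ) (hm : 7 ≤ m) (w : ℕ) :
    A m (m + 1) w ↔ (w = m - 1 ∨ w = m ∨ w = m + 3 ∨ w = m + 4) := by
  constructor
  · unfold A E
    rintro ((h | h | h | h | h | h | h | h | h | h | h | h | h | h) |
      (h | h | h | h | h | h | h | h | h | h | h | h | h | h)) <;> omega
  · rintro (h | h | h | h) <;> rw [h] <;>
      first
      | exact A_p (by omega) (by omega) (by omega)
      | exact A_symm (A_p (by omega) (by omega) (by omega))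
      | (unfold A E; simp)

theorem nbg2 (m : ℕ) (hm : 7 ≤ m) (w : ℕ) :
    A m (m + 2) w ↔ (w = 0 ∨ w = m ∨ w = m + 3 ∨ w = m + 4) := by
  constructor
  · unfold A E
    rintro ((h | h | h | h | h | h | h | h | h | h | h | h | h | h) |
      (h | h | h | h | h | h | h | h | h | h | h | h | h | h)) <;> omega
  · rintro (h | h | h | h) <;> rw [h] <;>
      first
      | exact A_p (by omega) (by omega) (by omega)
      | exact A_symm (A_p (by omega) (by omega) (by omega))
      | (unfold A E; simp)

theorem nbg3 (m : ℕ) (hm : 7 ≤ m) (w : ℕ) :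
    A m (m + 3) w ↔ (w = m ∨ w = m + 1 ∨ w = m + 2 ∨ w = m + 4) := by
  constructor
  · unfold A E
    rintro ((h | h | h | h | h | h | h | h | h | h | h | h | h | h) |
      (h | h | h | h | h | h | h | h | h | h | h | h | h | h)) <;> omega
  · rintro (h | h | h | h) <;> rw [h] <;>
      first
      | exact A_p (by omega) (by omega) (by omega)
      | exact A_symm (A_p (by omega) (by omega) (by omega))
      | (unfold A E; simp)

theorem nbg4 (m : ℕ) (hm : 7 ≤ m) (w : ℕ) :
    A m (m + 4) w ↔ (w = m - 1 ∨ w = m + 1 ∨ w = m + 2 ∨ w = m + 3) := by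
  constructor
  · unfold A E
    rintro ((h | h | h | h | h | h | h | h | h | h | h | h | h | h) |
      (h | h | h | h | h | h | h | h | h | h | h | h | h | h)) <;> omega
  · rintro (h | h | h | h) <;> rw [h] <;>
      first
      | exact A_p (by omega) (by omega) (by omega)
      | exact A_symm (A_p (by omega) (by omega) (by omega))
      | (unfold A E; simp)

theorem nbi (m : ℕ) (v : ℕ) (h1 : 2 ≤ v) (h2 : v ≤ m - 3) (w : ℕ) :
    A m v w ↔ (w = v - 2 ∨ w = v - 1 ∨ w = v + 1 ∨ w = v + 2) := by
  constructor
  · unfold A E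
    rintro ((h | h | h | h | h | h | h | h | h | h | h | h | h | h) |
      (h | h | h | h | h | h | h | h | h | h | h | h | h | h)) <;> omega
  · rintro (h | h | h | h) <;> rw [h] <;>
      first
      | exact A_p (by omega) (by omega) (by omega)
      | exact A_symm (A_p (by omega) (by omega) (by omega))
      | (unfold A E; simp)

theorem A_nb (m : ℕ) (hm : 7 ≤ m) (v : ℕ) (hv : v < m + 5) :
    ∃ a b c d, a < b ∧ b < c ∧ c < d ∧ d < m + 5 ∧
      ∀ w, A m v w ↔ (w = a ∨ w = b ∨ w = c ∨ w = d) := by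
  have hcase : v = 0 ∨ v = 1 ∨ (2 ≤ v ∧ v ≤ m - 3) ∨ v = m - 2 ∨ v = m - 1 ∨ v = m ∨ v = m + 1 ∨
    v = m + 2 ∨ v = m + 3 ∨ v = m + 4 := by omega
  rcases hcase with rfl | rfl | h | rfl | rfl | rfl | rfl | rfl | rfl | rfl
  · exact ⟨_, _, _, _, by omega, by omega, by omega, by omega, nb0 _ hm⟩
  · exact ⟨_, _, _, _, by omega, by omega, by omega, by omega, nb1 _ hm⟩
  · exact ⟨_, _, _, _, by omega, by omega, by omega, by omega, nbi m v h.1 h.2⟩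
  · exact ⟨_, _, _, _, by omega, by omega, by omega, by omega, nbm2 _ hm⟩
  · exact ⟨_, _, _, _, by omega, by omega, by omega, by omega, nbm1 _ hm⟩
  · exact ⟨_, _, _, _, by omega, by omega, by omega, by omega, nbg0 _ hm⟩
  · exact ⟨_, _, _, _, by omega, by omega, by omega, by omega, nbg1 _ hm⟩
  · exact ⟨_, _, _, _, by omega, by omega, by omega, by omega, nbg2 _ hm⟩
  · exact ⟨_, _, _, _, by omega, by omega, by omega, by omega, nbg3 _ hm⟩
  · exact ⟨_, _, _, _, by omega, by omega, by omega, by omega, nbg4 _ hm⟩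

/-- Edges lying in no triangle. -/
def Q (m u v : ℕ) : Prop := A m u v ∧ ∀ w, w < m + 5 → A m u w → A m v w → False

/-- The list of edges lying in no triangle (oriented upwards). -/
def L (m u v : ℕ) : Prop := (u = 0 ∧ v = m - 2) ∨ (u = 0 ∧ v = m + 2) ∨ (u = 1 ∧ v = m)

theorem Q_of_L (m : ℕ) (hm : 7 ≤ m) (u v : ℕ) (h : L m u v) : Q m u v := by
  unfold L at h
  rcases h with ⟨rfl, rfl⟩ | ⟨rfl, rfl⟩ | ⟨rfl, rfl⟩
  · refine ⟨(nb0 m hm _).2 (by omega), fun w _ h1 h2 => ?_⟩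
    rw [nb0 m hm] at h1
    rw [nbm2 m hm] at h2
    omega
  · refine ⟨(nb0 m hm _).2 (by omega), fun w _ h1 h2 => ?_⟩
    rw [nb0 m hm] at h1
    rw [nbg2 m hm] at h2
    omega
  · refine ⟨(nb1 _ hm _).2 (by omega), fun w _ h1 h2 => ?_⟩
    rw [nb1 _ hm] at h1
    rw [nbg0 _ hm] at h2
    omega

theorem Q_symm {m u v : ℕ} (h : Q m u v) : Q m v u :=
  ⟨A_symm h.1, fun w hw h1 h2 => h.2 w hw h2 h1⟩

theorem L_of_QE (m : ℕ) (hm : 7 ≤ m) (u v : ℕ) (hE : E m u v)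
    (h : ∀ w, w < m + 5 → A m u w → A m v w → False) : L m u v := by
  by_contra hL
  unfold L at hL
  have wit : ∀ w, w < m + 5 → A m u w → ¬ A m v w := h
  unfold E at hE
  have red : ∀ a b w, u = a ∧ v = b → w < m + 5 → A m a w → A m b w → False := by
    rintro a b w ⟨rfl, rfl⟩ hw h1 h2
    exact wit w hw h1 h2
  rcases hE with h1 | h1 | h1 | h1 | h1 | h1 | h1 | h1 | h1 | h1 | h1 | h1 | h1 | h1
  · by_cases e : v = u + 2
    · exact wit (u + 1) (by omega) (A_p (by omega) (by omega) (by omega))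
        (A_symm (A_p (by omega) (by omega) (by omega)))
    · by_cases e2 : v + 1 < m
      · exact wit (u + 2) (by omega) (A_p (by omega) (by omega) (by omega))
          (A_p (by omega) (by omega) (by omega))
      · exact wit (u - 1) (by omega) (A_symm (A_p (by omega) (by omega) (by omega)))
          (A_symm (A_p (by omega) (by omega) (by omega)))
  · omega
  · omega
  · omega
  · exact red _ _ (m + 4) h1 (by omega) ((nbm1 m hm _).2 (by omega)) ((nbg1 m hm _).2 (by omega))
  · exact red _ _ (m + 1) h1 (by omega) ((nbm1 m hm _).2 (by omega)) ((nbg4 m hm _).2 (by omega))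
  · exact red _ _ (m + 3) h1 (by omega) ((nbg0 m hm _).2 (by omega)) ((nbg1 m hm _).2 (by omega))
  · exact red _ _ (m + 3) h1 (by omega) ((nbg0 m hm _).2 (by omega)) ((nbg2 m hm _).2 (by omega))
  · exact red _ _ (m + 1) h1 (by omega) ((nbg0 m hm _).2 (by omega)) ((nbg3 m hm _).2 (by omega))
  · exact red _ _ (m) h1 (by omega) ((nbg1 m hm _).2 (by omega)) ((nbg3 m hm _).2 (by omega))
  · exact red _ _ (m + 3) h1 (by omega) ((nbg1 m hm _).2 (by omega)) ((nbg4 m hm _).2 (by omega))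
  · exact red _ _ (m) h1 (by omega) ((nbg2 m hm _).2 (by omega)) ((nbg3 m hm _).2 (by omega))
  · exact red _ _ (m + 3) h1 (by omega) ((nbg2 m hm _).2 (by omega)) ((nbg4 m hm _).2 (by omega))
  · exact red _ _ (m + 1) h1 (by omega) ((nbg3 m hm _).2 (by omega)) ((nbg4 m hm _).2 (by omega))

theorem L_of_Q (m : ℕ) (hm : 7 ≤ m) (u v : ℕ) (h : Q m u v) : L m u v ∨ L m v u := by
  rcases h.1 with h1 | h1
  · exact Or.inl (L_of_QE m hm u v h1 h.2)
  · exact Or.inr (L_of_QE m hm v u h1 (Q_symm h).2)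

/-- Rigidity of the sparse graph, phrased with a map on natural numbers. -/
theorem rigid (m : ℕ) (hm : 7 ≤ m) (s : ℕ → ℕ) (hlt : ∀ u, u < m + 5 → s u < m + 5)
    (hinj : ∀ u v, u < m + 5 → v < m + 5 → s u = s v → u = v)
    (hA : ∀ u v, u < m + 5 → v < m + 5 → (A m (s u) (s v) ↔ A m u v))
    (hQ : ∀ u v, u < m + 5 → v < m + 5 → (Q m (s u) (s v) ↔ Q m u v)) :
    ∀ v, v < m + 5 → s v = v := by
  have iL : ∀ u v, u < m + 5 → v < m + 5 → L m u v → L m (s u) (s v) ∨ L m (s v) (s u) :=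
    fun u v hu hv h => L_of_Q m hm _ _ ((hQ u v hu hv).2 (Q_of_L m hm u v h))
  have nL : ∀ u v, u < m + 5 → v < m + 5 → ¬ L m u v → ¬ L m v u → ¬ L m (s u) (s v) := by
    intro u v hu hv h h' hs
    rcases L_of_Q m hm u v ((hQ u v hu hv).1 (Q_of_L m hm _ _ hs)) with h1 | h1
    · exact h h1
    · exact h' h1
  have iA : ∀ u v, u < m + 5 → v < m + 5 → A m u v → A m (s u) (s v) :=
    fun u v hu hv h => (hA u v hu hv).2 h
  have s0 : s 0 = 0 := by
    have h1 := iL 0 (m - 2) (by omega) (by omega) (by unfold L; omega)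
    have h2 := iL 0 (m + 2) (by omega) (by omega) (by unfold L; omega)
    have h3 := hinj (m - 2) (m + 2) (by omega) (by omega)
    unfold L at h1 h2
    omega
  have s1 : s 1 = 1 := by
    have h1 := iL 1 m (by omega) (by omega) (by unfold L; omega)
    have h2 := iA 0 1 (by omega) (by omega) ((nb0 m hm _).2 (by omega))
    have h3 := nL 0 1 (by omega) (by omega) (by unfold L; omega) (by unfold L; omega)
    rw [s0] at h2 h3
    unfold L at h1 h3
    rw [nb0 m hm] at h2
    omega
  have sm : s m = m := by
    have h1 := iL 1 m (by omega) (by omega) (by unfold L; omega)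
    rw [s1] at h1
    unfold L at h1
    omega
  have s2 : s 2 = 2 := by
    have h2 := iA 0 2 (by omega) (by omega) ((nb0 m hm _).2 (by omega))
    have h3 := nL 0 2 (by omega) (by omega) (by unfold L; omega) (by unfold L; omega)
    have h4 := hinj 2 1 (by omega) (by omega)
    rw [s0] at h2 h3
    unfold L at h3
    rw [nb0 m hm] at h2
    omega
  have s3 : s 3 = 3 := by
    have h2 := iA 1 3 (by omega) (by omega) ((nb1 m hm _).2 (by omega))
    have h4 := hinj 3 0 (by omega) (by omega)
    have h5 := hinj 3 2 (by omega) (by omega)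
    have h6 := hinj 3 m (by omega) (by omega)
    rw [s1] at h2
    rw [nb1 m hm] at h2
    omega
  have path : ∀ i, i < m → s i = i := by
    intro i
    induction i using Nat.strong_induction_on with
    | _ i ih =>
      intro hi
      by_cases h4 : i < 4
      · interval_cases i <;> assumption
      · have e1 := ih (i - 1) (by omega) (by omega)
        have e2 := ih (i - 2) (by omega) (by omega)
        have e3 := ih (i - 3) (by omega) (by omega)
        have e4 := ih (i - 4) (by omega) (by omega)
        have h2 := iA (i - 2) i (by omega) (by omega) (A_p (by omega) (by omega) (by omega))
        have f1 := hinj i (i - 1) (by omega) (by omega)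
        have f3 := hinj i (i - 3) (by omega) (by omega)
        have f4 := hinj i (i - 4) (by omega) (by omega)
        rw [e2] at h2
        rw [nbi m (i - 2) (by omega) (by omega)] at h2
        omega
  have t1 := path (m - 1) (by omega)
  have t2 := path (m - 2) (by omega)
  have g2 : s (m + 2) = m + 2 := by
    have h2 := iA 0 (m + 2) (by omega) (by omega) ((nb0 m hm _).2 (by omega))
    have f1 := hinj (m + 2) 1 (by omega) (by omega)
    have f2 := hinj (m + 2) 2 (by omega) (by omega)
    have f3 := hinj (m + 2) (m - 2) (by omega) (by omega)
    rw [s0] at h2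
    rw [nb0 m hm] at h2
    omega
  have g1 : s (m + 1) = m + 1 := by
    have h2 := iA m (m + 1) (by omega) (by omega) ((nbg0 m hm _).2 (by omega))
    have h3 := iA (m - 1) (m + 1) (by omega) (by omega) ((nbm1 m hm _).2 (by omega))
    rw [sm] at h2
    rw [t1] at h3
    have f1 := hinj (m + 1) 1 (by omega) (by omega)
    rw [nbg0 m hm] at h2
    rw [nbm1 m hm] at h3
    omega
  have g3 : s (m + 3) = m + 3 := by
    have h2 := iA m (m + 3) (by omega) (by omega) ((nbg0 m hm _).2 (by omega))
    rw [sm] at h2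
    have f1 := hinj (m + 3) 1 (by omega) (by omega)
    have f2 := hinj (m + 3) (m + 1) (by omega) (by omega)
    have f3 := hinj (m + 3) (m + 2) (by omega) (by omega)
    rw [nbg0 m hm] at h2
    omega
  have g4 : s (m + 4) = m + 4 := by
    have h2 := iA (m + 3) (m + 4) (by omega) (by omega) ((nbg3 m hm _).2 (by omega))
    rw [g3] at h2
    have f1 := hinj (m + 4) m (by omega) (by omega)
    have f2 := hinj (m + 4) (m + 1) (by omega) (by omega)
    have f3 := hinj (m + 4) (m + 2) (by omega) (by omega)
    rw [nbg3 m hm] at h2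
    omega
  intro v hv
  by_cases h : v < m
  · exact path v h
  · have : v = m ∨ v = m + 1 ∨ v = m + 2 ∨ v = m + 3 ∨ v = m + 4 := by omega
    rcases this with rfl | rfl | rfl | rfl | rfl <;> assumption

/-- The sparse graph. -/
def H (m : ℕ) (hm : 7 ≤ m) : SimpleGraph (Fin (m + 5)) where
  Adj u v := A m u v
  symm := ⟨fun _ _ h => A_symm h⟩
  loopless := ⟨fun u h => by unfold A E at h; omega⟩

theorem H_adj (m : ℕ) (hm : 7 ≤ m) (u v : Fin (m + 5)) : (H m hm).Adj u v ↔ A m u v := Iff.rfl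

theorem H_degree (m : ℕ) (hm : 7 ≤ m) (v : Fin (m + 5)) :
    ((H m hm).neighborSet v).ncard = 4 := by
  obtain ⟨a, b, c, d, h1, h2, h3, h4, h5⟩ := A_nb m hm v v.2
  have : (H m hm).neighborSet v = (({⟨a, by omega⟩, ⟨b, by omega⟩, ⟨c, by omega⟩, ⟨d, by omega⟩} :
      Finset (Fin (m + 5))) : Set (Fin (m + 5))) := by
    ext w
    simp only [SimpleGraph.mem_neighborSet, H_adj, h5, Finset.coe_insert, Finset.coe_singleton,
      Set.mem_insert_iff, Set.mem_singleton_iff, Fin.ext_iff]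
  rw [this, Set.ncard_coe_finset]
  rw [Finset.card_insert_of_notMem, Finset.card_insert_of_notMem, Finset.card_insert_of_notMem,
    Finset.card_singleton] <;> simp [Fin.ext_iff] <;> omega

theorem H_rigid (m : ℕ) (hm : 7 ≤ m) (σ : Equiv.Perm (Fin (m + 5)))
    (hσ : ∀ u v, (H m hm).Adj (σ u) (σ v) ↔ (H m hm).Adj u v) (v : Fin (m + 5)) : σ v = v := by
  let s : ℕ → ℕ := fun u => if h : u < m + 5 then (σ ⟨u, h⟩).val else 0
  have hs : ∀ u (h : u < m + 5), s u = (σ ⟨u, h⟩).val := fun u h => dif_pos h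
  have hA : ∀ u v, u < m + 5 → v < m + 5 → (A m (s u) (s v) ↔ A m u v) := by
    intro u v hu hv
    rw [hs u hu, hs v hv]
    exact hσ ⟨u, hu⟩ ⟨v, hv⟩
  have hlt : ∀ u, u < m + 5 → s u < m + 5 := by
    intro u hu
    rw [hs u hu]
    exact (σ ⟨u, hu⟩).2
  have := rigid m hm s hlt ?_ hA ?_ v.val v.2
  · rw [hs v.val v.2] at this
    exact Fin.ext this
  · intro u v hu hv h
    rw [hs u hu, hs v hv] at h
    have := σ.injective (Fin.ext h)
    exact Fin.ext_iff.1 this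
  · intro u v hu hv
    unfold Q
    rw [hA u v hu hv]
    refine and_congr_right fun _ => ⟨fun h w hw h1 h2 => ?_, fun h w hw h1 h2 => ?_⟩
    · exact h (s w) (hlt w hw) ((hA u w hu hw).2 h1) ((hA v w hv hw).2 h2)
    · have hw' : s (σ.symm ⟨w, hw⟩).val = w := by
        rw [hs _ (σ.symm ⟨w, hw⟩).2]
        simp
      rw [← hw'] at h1 h2
      exact h _ (σ.symm ⟨w, hw⟩).2 ((hA u _ hu (σ.symm ⟨w, hw⟩).2).1 h1)
        ((hA v _ hv (σ.symm ⟨w, hw⟩).2).1 h2)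

theorem baseLarge (m : ℕ) (hm : 7 ≤ m) :
    ∃ (V : Type) (_ : Fintype V) (G : SimpleGraph V), Good G m := by
  refine ⟨Fin (m + 5), inferInstance, (H m hm)ᶜ, ?_, ?_, ?_⟩
  · refine ⟨fun u v => ?_⟩
    by_cases huv : u = v
    · subst huv; exact SimpleGraph.Reachable.refl _
    have h1 : (((H m hm).neighborSet u ∪ (H m hm).neighborSet v) ∪ {u, v})ᶜ.Nonempty := by
      apply Set.nonempty_of_ncard_ne_zero
      have h2 := Set.ncard_union_le ((H m hm).neighborSet u ∪ (H m hm).neighborSet v) {u, v}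
      have h3 := Set.ncard_union_le ((H m hm).neighborSet u) ((H m hm).neighborSet v)
      have h4 := Set.ncard_insert_le u {v}
      have h5 := Set.ncard_add_ncard_compl
        (((H m hm).neighborSet u ∪ (H m hm).neighborSet v) ∪ {u, v})
      rw [Set.ncard_singleton] at h4
      rw [H_degree, H_degree] at h3
      rw [Nat.card_eq_fintype_card, Fintype.card_fin] at h5
      omega
    obtain ⟨w, hw⟩ := h1
    simp only [Set.mem_compl_iff, Set.mem_union, SimpleGraph.mem_neighborSet, Set.mem_insert_iff,
      Set.mem_singleton_iff, not_or] at hw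
    have a1 : (H m hm)ᶜ.Adj u w := (SimpleGraph.compl_adj _ _ _).2 ⟨fun e => hw.2.1 e.symm, hw.1.1⟩
    have a2 : (H m hm)ᶜ.Adj v w := (SimpleGraph.compl_adj _ _ _).2 ⟨fun e => hw.2.2 e.symm, hw.1.2⟩
    exact a1.reachable.trans a2.reachable.symm
  · intro v
    have h1 : (H m hm)ᶜ.neighborSet v = (insert v ((H m hm).neighborSet v))ᶜ := by
      ext w
      simp only [SimpleGraph.mem_neighborSet, SimpleGraph.compl_adj, Set.mem_compl_iff,
        Set.mem_insert_iff, not_or]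
      exact and_congr_left fun _ => ne_comm
    have h2 := Set.ncard_add_ncard_compl (insert v ((H m hm).neighborSet v))
    rw [Set.ncard_insert_of_notMem (by simp) (Set.toFinite _), H_degree, ← h1,
      Nat.card_eq_fintype_card, Fintype.card_fin] at h2
    omega
  · intro σ hσ
    apply H_rigid m hm σ
    intro u v
    have h := hσ u v
    simp only [SimpleGraph.compl_adj, ne_eq, σ.injective.eq_iff] at h
    by_cases e : u = v
    · subst e
      simp only [SimpleGraph.irrefl]
    · have e' : ¬ v = u := fun x => e x.symm
      by_cases h1 : (H m hm).Adj (σ u) (σ v) <;> by_cases h2 : (H m hm).Adj u v <;>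
        simp_all

end AsymReg

/-- For every `d ≥ 3` and every natural number `N` there exists a connected `d`-regular
graph on more than `N` vertices with trivial automorphism group. -/
theorem exists_asymmetric_regular (d : ℕ) (hd : 3 ≤ d) (N : ℕ) :
    ∃ (n : ℕ) (G : SimpleGraph (Fin n)),
      G.Connected ∧ G.IsRegularOfDegree d ∧ N < n ∧ G.autGroup = ⊥ := by
  apply AsymReg.transfer
  apply AsymReg.grow d hd
  by_cases h : 7 ≤ d
  · exact AsymReg.baseLarge d h
  · have : d = 3 ∨ d = 4 ∨ d = 5 ∨ d = 6 := by omega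
    rcases this with rfl | rfl | rfl | rfl
    · exact AsymReg.base3
    · exact AsymReg.base4
    · exact AsymReg.base5
    · exact AsymReg.base6
end

section
/- For every finite group 𝔊 there exists a finite connected cubic (3-regular) simple graph G whose automorphism group Aut(G) is isomorphic (as a group) to 𝔊. -/
open scoped Classical

namespace FruchtCubic

/-- Data of a cubic base graph on `I` with a Hamiltonian cycle (`nx`, `pv`), a perfect
matching of chords `mt`, and group-valued voltages `t` on the chords. -/
structure Data (𝔊 : Type*) [Group 𝔊] (I : Type*) where
  nx : I → I
  pv : I → I
  mt : I → I
  t : I → 𝔊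
  nx_pv : ∀ i, nx (pv i) = i
  pv_nx : ∀ i, pv (nx i) = i
  mt_mt : ∀ i, mt (mt i) = i
  nx_ne : ∀ i, nx i ≠ i
  mt_ne : ∀ i, mt i ≠ i
  nx_ne_pv : ∀ i, nx i ≠ pv i
  mt_ne_nx : ∀ i, mt i ≠ nx i
  mt_ne_pv : ∀ i, mt i ≠ pv i
  t_mt : ∀ i, t (mt i) = (t i)⁻¹

variable {𝔊 : Type*} [Group 𝔊] {I : Type*} (D : Data 𝔊 I)

/-- The voltage lift. -/
def Data.graph : SimpleGraph (𝔊 × I) where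
  Adj u v := (v.2 = D.nx u.2 ∧ v.1 = u.1) ∨ (v.2 = D.pv u.2 ∧ v.1 = u.1) ∨
    (v.2 = D.mt u.2 ∧ v.1 = u.1 * D.t u.2)
  symm := ⟨by
    rintro ⟨g, i⟩ ⟨h, j⟩ (⟨h1, h2⟩ | ⟨h1, h2⟩ | ⟨h1, h2⟩) <;> simp only at h1 h2 ⊢ <;> subst h1 h2
    · right; left; simp [D.pv_nx]
    · left; simp [D.nx_pv]
    · right; right; simp [D.mt_mt, D.t_mt]⟩
  loopless := ⟨by
    rintro ⟨g, i⟩ (⟨h1, h2⟩ | ⟨h1, h2⟩ | ⟨h1, h2⟩) <;> simp only at h1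
    · exact D.nx_ne i h1.symm
    · have := D.nx_pv i
      rw [← h1] at this
      exact D.nx_ne i this
    · exact D.mt_ne i h1.symm⟩

/-- Adjacency in the base graph. -/
def Data.Q (i j : I) : Prop := j = D.nx i ∨ j = D.pv i ∨ j = D.mt i

lemma Data.adj_iff (u v : 𝔊 × I) : D.graph.Adj u v ↔
    (v.2 = D.nx u.2 ∧ v.1 = u.1) ∨ (v.2 = D.pv u.2 ∧ v.1 = u.1) ∨
    (v.2 = D.mt u.2 ∧ v.1 = u.1 * D.t u.2) := Iff.rfl

lemma Data.Q_of_adj {u v : 𝔊 × I} (h : D.graph.Adj u v) : D.Q u.2 v.2 := by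
  rw [D.adj_iff] at h
  unfold Data.Q
  tauto

lemma Data.exists_adj (g : 𝔊) {i j : I} (h : D.Q i j) : ∃ g', D.graph.Adj (g, i) (g', j) := by
  rcases h with h | h | h
  · exact ⟨g, Or.inl ⟨h, rfl⟩⟩
  · exact ⟨g, Or.inr (Or.inl ⟨h, rfl⟩)⟩
  · exact ⟨g * D.t i, Or.inr (Or.inr ⟨h, rfl⟩)⟩

lemma Data.degree [D.graph.LocallyFinite] : D.graph.IsRegularOfDegree 3 := by
  rintro ⟨g, i⟩
  have : D.graph.neighborFinset (g, i) =
      {(g, D.nx i), (g, D.pv i), (g * D.t i, D.mt i)} := by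
    ext ⟨h, j⟩
    simp only [SimpleGraph.mem_neighborFinset, D.adj_iff, Finset.mem_insert,
      Finset.mem_singleton, Prod.mk.injEq]
    tauto
  rw [← SimpleGraph.card_neighborFinset_eq_degree, this, Finset.card_eq_three]
  refine ⟨_, _, _, ?_, ?_, ?_, rfl⟩
  · intro h; exact D.nx_ne_pv i (Prod.mk.inj h).2
  · intro h; exact D.mt_ne_nx i (Prod.mk.inj h).2.symm
  · intro h; exact D.mt_ne_pv i (Prod.mk.inj h).2.symm

lemma Data.reach_iter (g : 𝔊) (i : I) (k : ℕ) : D.graph.Reachable (g, i) (g, D.nx^[k] i) := by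
  induction k with
  | zero => exact SimpleGraph.Reachable.refl _
  | succ k ih =>
    refine ih.trans (SimpleGraph.Adj.reachable ?_)
    rw [Function.iterate_succ_apply']
    exact Or.inl ⟨rfl, rfl⟩

lemma Data.connected (htr : ∀ i j, ∃ k, D.nx^[k] i = j) (hs : ∀ s, ∃ i, D.t i = s) :
    D.graph.Connected := by
  have h1 : ∀ g i j, D.graph.Reachable (g, i) (g, j) := by
    intro g i j
    obtain ⟨k, rfl⟩ := htr i j
    exact D.reach_iter g i k
  obtain ⟨i0, -⟩ := hs 1
  have : Nonempty (𝔊 × I) := ⟨(1, i0)⟩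
  refine SimpleGraph.Connected.mk ?_
  rintro ⟨g, i⟩ ⟨h, j⟩
  obtain ⟨k, hk⟩ := hs (g⁻¹ * h)
  have h2 : D.graph.Adj (g, k) (h, D.mt k) := Or.inr (Or.inr ⟨rfl, by simp [hk]⟩)
  exact ((h1 g i k).trans h2.reachable).trans (h1 h _ j)

/-- A set of colours preserved by all automorphisms. -/
def Data.Inv (S : Set I) : Prop :=
  ∀ φ ∈ D.graph.autGroup, ∀ v : 𝔊 × I, v.2 ∈ S → (φ v).2 ∈ S

variable {D}

lemma Data.Inv.iff {S : Set I} (h : D.Inv S) {φ} (hφ : φ ∈ D.graph.autGroup) (v : 𝔊 × I) :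
    (φ v).2 ∈ S ↔ v.2 ∈ S := by
  refine ⟨fun hv => ?_, h φ hφ v⟩
  have := h φ⁻¹ (inv_mem hφ) (φ v) hv
  simpa using this

lemma Data.Inv.compl {S : Set I} (h : D.Inv S) : D.Inv Sᶜ := by
  intro φ hφ v hv
  simpa [h.iff hφ v] using hv

lemma Data.Inv.inter {S T : Set I} (h : D.Inv S) (h' : D.Inv T) : D.Inv (S ∩ T) :=
  fun φ hφ v hv => ⟨h φ hφ v hv.1, h' φ hφ v hv.2⟩

/-- colours having a neighbour in `S` -/
def Data.dia (D : Data 𝔊 I) (S : Set I) : Set I := {i | ∃ j ∈ S, D.Q i j}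

lemma Data.Inv.dia {S : Set I} (h : D.Inv S) : D.Inv (D.dia S) := by
  rintro φ hφ ⟨g, i⟩ ⟨j, hj, hQ⟩
  obtain ⟨g', ha⟩ := D.exists_adj g hQ
  exact ⟨(φ (g', j)).2, h φ hφ _ hj, D.Q_of_adj ((hφ _ _).2 ha)⟩

/-- colours in a triangle of the base graph all of whose voltages are trivial, when all
triangles of the base graph are such. -/
lemma Data.Inv.tri {T : Set I}
    (h1 : ∀ i j k, D.Q i j → D.Q j k → D.Q k i → i ∈ T)
    (h2 : ∀ i ∈ T, ∃ j k, ∀ g, D.graph.Adj (g, i) (g, j) ∧ D.graph.Adj (g, j) (g, k) ∧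
      D.graph.Adj (g, k) (g, i)) : D.Inv T := by
  rintro φ hφ ⟨g, i⟩ hv
  obtain ⟨j, k, h⟩ := h2 i hv
  obtain ⟨a, b, c⟩ := h g
  exact h1 _ _ _ (D.Q_of_adj ((hφ _ _).2 a)) (D.Q_of_adj ((hφ _ _).2 b))
    (D.Q_of_adj ((hφ _ _).2 c))

variable (D)

/-- left translations -/
def Data.trans : 𝔊 →* D.graph.autGroup where
  toFun x := ⟨Equiv.prodCongr (Equiv.mulLeft x) (Equiv.refl I), by
    rintro ⟨g, i⟩ ⟨h, j⟩
    simp [D.adj_iff, mul_assoc]⟩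
  map_one' := by ext ⟨g, i⟩ <;> simp
  map_mul' x y := by ext ⟨g, i⟩ <;> simp [mul_assoc]

lemma Data.trans_apply (x : 𝔊) (v : 𝔊 × I) : (D.trans x : Equiv.Perm (𝔊 × I)) v = (x * v.1, v.2) :=
  rfl

lemma Data.trans_bij (htr : ∀ i j, ∃ k, D.nx^[k] i = j) (hs : ∀ s, ∃ i, D.t i = s)
    (hinv : ∀ i, D.Inv {i}) : Function.Bijective D.trans := by
  obtain ⟨i0, -⟩ := hs 1
  constructor
  · intro x y hxy
    have := D.trans_apply x (1, i0)
    rw [hxy, D.trans_apply] at this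
    simpa using (Prod.mk.inj this).1.symm
  · rintro ⟨φ, hφ⟩
    have hc : ∀ v, (φ v).2 = v.2 := fun v => hinv v.2 φ hφ v rfl
    have hn : ∀ g i, (φ (g, D.nx i)).1 = (φ (g, i)).1 := by
      intro g i
      have h : D.graph.Adj (g, i) (g, D.nx i) := Or.inl ⟨rfl, rfl⟩
      rw [← hφ, D.adj_iff, hc, hc] at h
      rcases h with h | h | h
      · exact h.2
      · exact absurd h.1 (D.nx_ne_pv i)
      · exact absurd h.1.symm (D.mt_ne_nx i)
    have hk : ∀ g i k, (φ (g, D.nx^[k] i)).1 = (φ (g, i)).1 := by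
      intro g i k
      induction k with
      | zero => rfl
      | succ k ih => rw [Function.iterate_succ_apply', hn, ih]
    have hij : ∀ g i j, (φ (g, i)).1 = (φ (g, j)).1 := by
      intro g i j
      obtain ⟨k, rfl⟩ := htr i j
      exact (hk g i k).symm
    have hm : ∀ g i, (φ (g * D.t i, D.mt i)).1 = (φ (g, i)).1 * D.t i := by
      intro g i
      have h : D.graph.Adj (g, i) (g * D.t i, D.mt i) := Or.inr (Or.inr ⟨rfl, rfl⟩)
      rw [← hφ, D.adj_iff, hc, hc] at h
      rcases h with h | h | h
      · exact absurd h.1 (D.mt_ne_nx i)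
      · exact absurd h.1 (D.mt_ne_pv i)
      · exact h.2
    refine ⟨(φ (1, i0)).1, ?_⟩
    apply Subtype.ext
    ext1 ⟨g, i⟩
    rw [D.trans_apply]
    refine Prod.ext ?_ (hc (g, i)).symm
    obtain ⟨k, rfl⟩ := hs g
    have := hm 1 k
    rw [one_mul] at this
    simp only
    rw [hij _ i (D.mt k), this, hij 1 i0 k]

lemma transfer {V W : Type*} (G : SimpleGraph V) (e : V ≃ W) :
    Nonempty ((G.comap e.symm).autGroup ≃* G.autGroup) := by
  refine ⟨(MulEquiv.trans (MulEquiv.subgroupMap e.permCongrHom G.autGroup)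
    (MulEquiv.subgroupCongr ?_)).symm⟩
  ext σ
  rw [Subgroup.mem_map]
  constructor
  · rintro ⟨τ, hτ, rfl⟩ u v
    have := hτ (e.symm u) (e.symm v)
    simpa using this
  · intro h
    refine ⟨e.permCongrHom.symm σ, ?_, MulEquiv.apply_symm_apply _ _⟩
    intro u v
    have := h (e u) (e v)
    simpa using this

lemma Data.main [Finite 𝔊] [Finite I] (htr : ∀ i j, ∃ k, D.nx^[k] i = j)
    (hs : ∀ s, ∃ i, D.t i = s) (hinv : ∀ i, D.Inv {i}) :
    ∃ (n : ℕ) (G : SimpleGraph (Fin n)),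
      G.Connected ∧ G.IsRegularOfDegree 3 ∧ Nonempty (G.autGroup ≃* 𝔊) := by
  obtain ⟨n, ⟨e⟩⟩ := Finite.exists_equiv_fin (𝔊 × I)
  let _ : Fintype (𝔊 × I) := Fintype.ofFinite _
  have f : D.graph.comap e.symm ≃g D.graph := SimpleGraph.Iso.comap e.symm D.graph
  refine ⟨n, D.graph.comap e.symm, ?_, ?_, ?_⟩
  · exact f.connected_iff.2 (D.connected htr hs)
  · intro v
    rw [← f.degree_eq]
    exact D.degree _
  · obtain ⟨m⟩ := transfer D.graph e
    exact ⟨m.trans (MulEquiv.ofBijective D.trans (D.trans_bij htr hs hinv)).symm⟩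


/-- successor on the Hamiltonian cycle -/
def nxN (m i : ℕ) : ℕ := if i + 1 = 14 + 2 * m then 0 else i + 1

/-- predecessor on the Hamiltonian cycle -/
def pvN (m i : ℕ) : ℕ := if i = 0 then 13 + 2 * m else i - 1

/-- the chords: a start gadget, an end gadget, and rungs of a ladder in between -/
def mtN (m i : ℕ) : ℕ :=
  if i = 0 then 2 else if i = 1 then 6 else if i = 2 then 0 else if i = 3 then 5 else
  if i = 4 then 7 else if i = 5 then 3 else if i = 6 then 1 else if i = 7 then 4 else
  if i = 8 + m then 11 + m else if i = 9 + m then 13 + m else if i = 10 + m then 12 + m else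
  if i = 11 + m then 8 + m else if i = 12 + m then 10 + m else if i = 13 + m then 9 + m else
  21 + 2 * m - i

/-- the voltages on the chords -/
def tN {𝔊 : Type*} [Group 𝔊] (s : ℕ → 𝔊) (m i : ℕ) : 𝔊 :=
  if i < 8 then 1 else if i < 8 + m then s (i - 8) else if i < 14 + m then 1 else
  (s (13 + 2 * m - i))⁻¹

lemma mtN_cases (m i : ℕ) (hi : i < 14 + 2 * m) :
    (i = 0 ∧ mtN m i = 2) ∨ (i = 1 ∧ mtN m i = 6) ∨ (i = 2 ∧ mtN m i = 0) ∨
    (i = 3 ∧ mtN m i = 5) ∨ (i = 4 ∧ mtN m i = 7) ∨ (i = 5 ∧ mtN m i = 3) ∨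
    (i = 6 ∧ mtN m i = 1) ∨ (i = 7 ∧ mtN m i = 4) ∨ (i = 8 + m ∧ mtN m i = 11 + m) ∨
    (i = 9 + m ∧ mtN m i = 13 + m) ∨ (i = 10 + m ∧ mtN m i = 12 + m) ∨
    (i = 11 + m ∧ mtN m i = 8 + m) ∨ (i = 12 + m ∧ mtN m i = 10 + m) ∨
    (i = 13 + m ∧ mtN m i = 9 + m) ∨
    (8 ≤ i ∧ i < 8 + m ∧ mtN m i = 21 + 2 * m - i) ∨
    (14 + m ≤ i ∧ mtN m i = 21 + 2 * m - i) := by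
  by_cases h0 : i = 0
  · exact Or.inl ⟨h0, by
      unfold mtN; rw [if_pos h0]⟩
  refine Or.inr ?_
  by_cases h1 : i = 1
  · exact Or.inl ⟨h1, by
      unfold mtN; rw [if_neg h0, if_pos h1]⟩
  refine Or.inr ?_
  by_cases h2 : i = 2
  · exact Or.inl ⟨h2, by
      unfold mtN; rw [if_neg h0, if_neg h1, if_pos h2]⟩
  refine Or.inr ?_
  by_cases h3 : i = 3
  · exact Or.inl ⟨h3, by
      unfold mtN; rw [if_neg h0, if_neg h1, if_neg h2, if_pos h3]⟩
  refine Or.inr ?_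
  by_cases h4 : i = 4
  · exact Or.inl ⟨h4, by
      unfold mtN; rw [if_neg h0, if_neg h1, if_neg h2, if_neg h3, if_pos h4]⟩
  refine Or.inr ?_
  by_cases h5 : i = 5
  · exact Or.inl ⟨h5, by
      unfold mtN; rw [if_neg h0, if_neg h1, if_neg h2, if_neg h3, if_neg h4, if_pos h5]⟩
  refine Or.inr ?_
  by_cases h6 : i = 6
  · exact Or.inl ⟨h6, by
      unfold mtN; rw [if_neg h0, if_neg h1, if_neg h2, if_neg h3, if_neg h4, if_neg h5, if_pos h6]⟩
  refine Or.inr ?_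
  by_cases h7 : i = 7
  · exact Or.inl ⟨h7, by
      unfold mtN; rw [if_neg h0, if_neg h1, if_neg h2, if_neg h3, if_neg h4, if_neg h5, if_neg h6, if_pos h7]⟩
  refine Or.inr ?_
  by_cases h8 : i = 8 + m
  · exact Or.inl ⟨h8, by
      unfold mtN; rw [if_neg h0, if_neg h1, if_neg h2, if_neg h3, if_neg h4, if_neg h5, if_neg h6, if_neg h7, if_pos h8]⟩
  refine Or.inr ?_
  by_cases h9 : i = 9 + m
  · exact Or.inl ⟨h9, by
      unfold mtN; rw [if_neg h0, if_neg h1, if_neg h2, if_neg h3, if_neg h4, if_neg h5, if_neg h6, if_neg h7, if_neg h8, if_pos h9]⟩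
  refine Or.inr ?_
  by_cases h10 : i = 10 + m
  · exact Or.inl ⟨h10, by
      unfold mtN; rw [if_neg h0, if_neg h1, if_neg h2, if_neg h3, if_neg h4, if_neg h5, if_neg h6, if_neg h7, if_neg h8, if_neg h9, if_pos h10]⟩
  refine Or.inr ?_
  by_cases h11 : i = 11 + m
  · exact Or.inl ⟨h11, by
      unfold mtN; rw [if_neg h0, if_neg h1, if_neg h2, if_neg h3, if_neg h4, if_neg h5, if_neg h6, if_neg h7, if_neg h8, if_neg h9, if_neg h10, if_pos h11]⟩
  refine Or.inr ?_
  by_cases h12 : i = 12 + m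
  · exact Or.inl ⟨h12, by
      unfold mtN; rw [if_neg h0, if_neg h1, if_neg h2, if_neg h3, if_neg h4, if_neg h5, if_neg h6, if_neg h7, if_neg h8, if_neg h9, if_neg h10, if_neg h11, if_pos h12]⟩
  refine Or.inr ?_
  by_cases h13 : i = 13 + m
  · exact Or.inl ⟨h13, by
      unfold mtN; rw [if_neg h0, if_neg h1, if_neg h2, if_neg h3, if_neg h4, if_neg h5, if_neg h6, if_neg h7, if_neg h8, if_neg h9, if_neg h10, if_neg h11, if_neg h12, if_pos h13]⟩
  refine Or.inr ?_
  have e : mtN m i = 21 + 2 * m - i := by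
    unfold mtN
    rw [if_neg h0, if_neg h1, if_neg h2, if_neg h3, if_neg h4, if_neg h5, if_neg h6, if_neg h7, if_neg h8, if_neg h9, if_neg h10, if_neg h11, if_neg h12, if_neg h13]
  rcases lt_or_ge i (8 + m) with h | h
  · exact Or.inl ⟨by omega, h, e⟩
  · exact Or.inr ⟨by omega, e⟩

lemma nxN_cases (m i : ℕ) (hi : i < 14 + 2 * m) :
    (i = 13 + 2 * m ∧ nxN m i = 0) ∨ (i < 13 + 2 * m ∧ nxN m i = i + 1) := by
  unfold nxN
  split_ifs <;> omega

lemma pvN_cases (m i : ℕ) : (i = 0 ∧ pvN m i = 13 + 2 * m) ∨ (0 < i ∧ pvN m i = i - 1) := by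
  unfold pvN
  split_ifs <;> omega

lemma mtN_lt (m i : ℕ) (hi : i < 14 + 2 * m) : mtN m i < 14 + 2 * m := by
  have := mtN_cases m i hi
  omega

lemma mtN_mtN (m i : ℕ) (hi : i < 14 + 2 * m) : mtN m (mtN m i) = i := by
  have h1 := mtN_cases m i hi
  have h2 := mtN_cases m (mtN m i) (mtN_lt m i hi)
  generalize mtN m (mtN m i) = y at *
  generalize mtN m i = x at *
  rcases h1 with h1 | h1 | h1 | h1 | h1 | h1 | h1 | h1 | h1 | h1 | h1 | h1 | h1 | h1 | h1 | h1 <;>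
    omega

lemma tN_mtN (s : ℕ → 𝔊) (m i : ℕ) (hi : i < 14 + 2 * m) :
    tN s m (mtN m i) = (tN s m i)⁻¹ := by
  have h1 := mtN_cases m i hi
  unfold tN
  by_cases h : 8 ≤ i ∧ i < 8 + m
  · rw [if_neg (by omega), if_neg (by omega), if_neg (by omega), if_neg (by omega),
      if_pos (by omega)]
    congr 2
    omega
  · by_cases h' : 14 + m ≤ i
    · rw [if_neg (by omega), if_pos (by omega), if_neg (by omega), if_neg (by omega),
        if_neg (by omega), inv_inv]
      congr 1
      omega
    · split_ifs <;> first | omega | simp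

/-- the concrete data -/
def conc (s : ℕ → 𝔊) (m : ℕ) : Data 𝔊 (Fin (14 + 2 * m)) where
  nx i := ⟨nxN m i, by have := nxN_cases m i i.2; omega⟩
  pv i := ⟨pvN m i, by have := pvN_cases m i; omega⟩
  mt i := ⟨mtN m i, mtN_lt m i i.2⟩
  t i := tN s m i
  nx_pv i := by
    ext; simp only
    have := pvN_cases m i
    have := nxN_cases m (pvN m i) (by omega)
    omega
  pv_nx i := by
    ext; simp only
    have := nxN_cases m i i.2
    have := pvN_cases m (nxN m i)
    omega
  mt_mt i := by ext; exact mtN_mtN m i i.2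
  nx_ne i := by
    rw [Ne, Fin.ext_iff]; simp only
    have := nxN_cases m i i.2
    omega
  mt_ne i := by
    rw [Ne, Fin.ext_iff]; simp only
    have := mtN_cases m i i.2
    omega
  nx_ne_pv i := by
    rw [Ne, Fin.ext_iff]; simp only
    have := nxN_cases m i i.2
    have := pvN_cases m i
    omega
  mt_ne_nx i := by
    rw [Ne, Fin.ext_iff]; simp only
    have := nxN_cases m i i.2
    have := mtN_cases m i i.2
    omega
  mt_ne_pv i := by
    rw [Ne, Fin.ext_iff]; simp only
    have := mtN_cases m i i.2
    have := pvN_cases m i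
    omega
  t_mt i := tN_mtN s m i i.2

/-- invariance of a predicate on positions -/
def CInv (s : ℕ → 𝔊) (m : ℕ) (P : ℕ → Prop) : Prop := (conc s m).Inv {i | P i}

/-- some neighbour satisfies `P` -/
def nb (m : ℕ) (P : ℕ → Prop) (i : ℕ) : Prop := P (nxN m i) ∨ P (pvN m i) ∨ P (mtN m i)

variable {s : ℕ → 𝔊} {m : ℕ} {P R : ℕ → Prop}

lemma CInv.congr (h : CInv s m P) (hPR : ∀ i < 14 + 2 * m, (P i ↔ R i)) : CInv s m R := by
  have : {i : Fin (14 + 2 * m) | P i} = {i : Fin (14 + 2 * m) | R i} := by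
    ext i; exact hPR i i.2
  unfold CInv at *
  rwa [← this]

lemma CInv.not (h : CInv s m P) : CInv s m (fun i => ¬ P i) := Data.Inv.compl h

lemma CInv.and (h : CInv s m P) (h' : CInv s m R) : CInv s m (fun i => P i ∧ R i) :=
  Data.Inv.inter h h'

lemma CInv.nb (h : CInv s m P) : CInv s m (nb m P) := by
  have := Data.Inv.dia h
  unfold CInv
  convert this using 1
  ext i
  constructor
  · rintro (h | h | h)
    · exact ⟨(conc s m).nx i, h, Or.inl rfl⟩
    · exact ⟨(conc s m).pv i, h, Or.inr (Or.inl rfl)⟩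
    · exact ⟨(conc s m).mt i, h, Or.inr (Or.inr rfl)⟩
  · rintro ⟨j, h, rfl | rfl | rfl⟩
    · exact Or.inl h
    · exact Or.inr (Or.inl h)
    · exact Or.inr (Or.inr h)

lemma CInv.step {a b d : ℕ} (c : ℕ) (ha : CInv s m (· = a)) (hb : CInv s m (· = b))
    (hd : CInv s m (· = d))
    (h : ∀ i < 14 + 2 * m, i = c ↔
      (nxN m i = a ∨ pvN m i = a ∨ mtN m i = a) ∧ i ≠ b ∧ i ≠ d) : CInv s m (· = c) :=
  (ha.nb.and (hb.not.and hd.not)).congr fun i hi => (h i hi).symm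

lemma iter_nx (s : ℕ → 𝔊) (m : ℕ) (i j : Fin (14 + 2 * m)) :
    ∃ k, (conc s m).nx^[k] i = j := by
  have h : ∀ (i : Fin (14 + 2 * m)) (k : ℕ) (hk : i + k < 14 + 2 * m),
      (conc s m).nx^[k] i = ⟨i + k, hk⟩ := by
    intro i k
    induction k with
    | zero => intro _; rfl
    | succ k ih =>
      intro hk
      rw [Function.iterate_succ_apply', ih (by omega)]
      ext
      change nxN m (i + k) = i + (k + 1)
      have := nxN_cases m (i + k) (by omega)
      omega
  refine ⟨j + (1 + (13 + 2 * m - i)), ?_⟩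
  rw [Function.iterate_add_apply, Function.iterate_add_apply, h i _ (by omega)]
  have h0 : (conc s m).nx^[1] ⟨i + (13 + 2 * m - i), by omega⟩ = ⟨0, by omega⟩ := by
    ext
    change nxN m (i + (13 + 2 * m - i)) = 0
    have := nxN_cases m (i + (13 + 2 * m - i)) (by omega)
    omega
  rw [h0, h _ _ (by simp)]
  ext; simp

/-- positions lying in a triangle -/
def TT (m i : ℕ) : Prop := i < 6 ∨ (10 + m ≤ i ∧ i < 13 + m)

lemma tri_abs {I : Type*} (D : Data 𝔊 I) {i j k : I} (h1 : D.Q i j) (h2 : D.Q j k)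
    (h3 : D.Q k i) : D.mt i = D.nx (D.nx i) ∨ D.mt i = D.pv (D.pv i) ∨
      D.mt (D.nx i) = D.pv i ∨ D.nx (D.nx (D.nx i)) = i := by
  have e1 := D.nx_pv
  have e2 := D.pv_nx
  have e3 := D.mt_mt
  have e4 := D.nx_ne
  have e5 := D.mt_ne
  unfold Data.Q at *
  rcases h1 with rfl | rfl | rfl <;> rcases h2 with rfl | rfl | rfl <;> grind

lemma tri_base (s : ℕ → 𝔊) (m : ℕ) (i j k : Fin (14 + 2 * m)) (h1 : (conc s m).Q i j)
    (h2 : (conc s m).Q j k) (h3 : (conc s m).Q k i) : TT m i := by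
  have h := tri_abs _ h1 h2 h3
  simp only [conc, Fin.ext_iff] at h
  clear h1 h2 h3
  obtain ⟨i, hi⟩ := i
  simp only at h ⊢
  have a1 := nxN_cases m i hi
  have b1 := pvN_cases m i
  have hn : nxN m i < 14 + 2 * m := by omega
  have a2 := nxN_cases m (nxN m i) hn
  unfold TT
  rcases h with h | h | h | h
  · have c1 := mtN_cases m i hi
    rw [h] at c1
    omega
  · have c1 := mtN_cases m i hi
    have b2 := pvN_cases m (pvN m i)
    rw [h] at c1
    omega
  · have c1 := mtN_cases m (nxN m i) hn
    rw [h] at c1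
    omega
  · have a3 := nxN_cases m (nxN m (nxN m i)) (by omega)
    omega

lemma all_cases (m : ℕ) (hm : 1 ≤ m) (i : ℕ) (hi : i < 14 + 2 * m) :
    (i = 0 ∧ nxN m i = 1 ∧ pvN m i = 13 + 2 * m ∧ mtN m i = 2) ∨
    (i = 1 ∧ nxN m i = 2 ∧ pvN m i = 0 ∧ mtN m i = 6) ∨
    (i = 2 ∧ nxN m i = 3 ∧ pvN m i = 1 ∧ mtN m i = 0) ∨
    (i = 3 ∧ nxN m i = 4 ∧ pvN m i = 2 ∧ mtN m i = 5) ∨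
    (i = 4 ∧ nxN m i = 5 ∧ pvN m i = 3 ∧ mtN m i = 7) ∨
    (i = 5 ∧ nxN m i = 6 ∧ pvN m i = 4 ∧ mtN m i = 3) ∨
    (i = 6 ∧ nxN m i = 7 ∧ pvN m i = 5 ∧ mtN m i = 1) ∨
    (i = 7 ∧ nxN m i = 8 ∧ pvN m i = 6 ∧ mtN m i = 4) ∨
    (i = 8 + m ∧ nxN m i = 9 + m ∧ pvN m i = 7 + m ∧ mtN m i = 11 + m) ∨
    (i = 9 + m ∧ nxN m i = 10 + m ∧ pvN m i = 8 + m ∧ mtN m i = 13 + m) ∨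
    (i = 10 + m ∧ nxN m i = 11 + m ∧ pvN m i = 9 + m ∧ mtN m i = 12 + m) ∨
    (i = 11 + m ∧ nxN m i = 12 + m ∧ pvN m i = 10 + m ∧ mtN m i = 8 + m) ∨
    (i = 12 + m ∧ nxN m i = 13 + m ∧ pvN m i = 11 + m ∧ mtN m i = 10 + m) ∨
    (i = 13 + m ∧ nxN m i = 14 + m ∧ pvN m i = 12 + m ∧ mtN m i = 9 + m) ∨
    ((8 ≤ i ∧ i < 8 + m) ∧ nxN m i = i + 1 ∧ pvN m i = i - 1 ∧ mtN m i = 21 + 2 * m - i) ∨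
    ((14 + m ≤ i ∧ i < 13 + 2 * m) ∧ nxN m i = i + 1 ∧ pvN m i = i - 1 ∧ mtN m i = 21 + 2 * m - i) ∨
    (i = 13 + 2 * m ∧ nxN m i = 0 ∧ pvN m i = 12 + 2 * m ∧ mtN m i = 8) := by
  have a := nxN_cases m i hi
  have b := pvN_cases m i
  have c := mtN_cases m i hi
  generalize nxN m i = x at *
  generalize pvN m i = y at *
  generalize mtN m i = z at *
  rcases c with c | c | c | c | c | c | c | c | c | c | c | c | c | c | c | c
  · left; omega
  · right; left; omega
  · right; right; left; omega
  · right; right; right; left; omega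
  · right; right; right; right; left; omega
  · right; right; right; right; right; left; omega
  · right; right; right; right; right; right; left; omega
  · right; right; right; right; right; right; right; left; omega
  · right; right; right; right; right; right; right; right; left; omega
  · right; right; right; right; right; right; right; right; right; left; omega
  · right; right; right; right; right; right; right; right; right; right; left; omega
  · right; right; right; right; right; right; right; right; right; right; right; left; omega
  · right; right; right; right; right; right; right; right; right; right; right; right; left; omega
  · right; right; right; right; right; right; right; right; right; right; right; right; right; left; omega
  · right; right; right; right; right; right; right; right; right; right; right; right; right; right; left; omega
  · by_cases h : i = 13 + 2 * m
    · right; right; right; right; right; right; right; right; right; right; right; right; right; right; right; right; omega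
    · right; right; right; right; right; right; right; right; right; right; right; right; right; right; right; left; omega

/-- case analysis over all positions -/
lemma elim_cases (m : ℕ) (hm : 1 ≤ m) {C : ℕ → ℕ → ℕ → ℕ → Prop}
    (_ : C (0) (1) (13 + 2 * m) (2))
    (_ : C (1) (2) (0) (6))
    (_ : C (2) (3) (1) (0))
    (_ : C (3) (4) (2) (5))
    (_ : C (4) (5) (3) (7))
    (_ : C (5) (6) (4) (3))
    (_ : C (6) (7) (5) (1))
    (_ : C (7) (8) (6) (4))
    (_ : C (8 + m) (9 + m) (7 + m) (11 + m))
    (_ : C (9 + m) (10 + m) (8 + m) (13 + m))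
    (_ : C (10 + m) (11 + m) (9 + m) (12 + m))
    (_ : C (11 + m) (12 + m) (10 + m) (8 + m))
    (_ : C (12 + m) (13 + m) (11 + m) (10 + m))
    (_ : C (13 + m) (14 + m) (12 + m) (9 + m))
    (_ : ∀ i, 8 ≤ i → i < 8 + m → C i (i + 1) (i - 1) (21 + 2 * m - i))
    (_ : ∀ i, 14 + m ≤ i → i < 13 + 2 * m → C i (i + 1) (i - 1) (21 + 2 * m - i))
    (_ : C (13 + 2 * m) 0 (12 + 2 * m) 8)
    (i : ℕ) (hi : i < 14 + 2 * m) : C i (nxN m i) (pvN m i) (mtN m i) := by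
  rcases all_cases m hm i hi with
    ⟨h1, h2, h3, h4⟩ | ⟨h1, h2, h3, h4⟩ | ⟨h1, h2, h3, h4⟩ | ⟨h1, h2, h3, h4⟩ | ⟨h1, h2, h3, h4⟩ | ⟨h1, h2, h3, h4⟩ | ⟨h1, h2, h3, h4⟩ | ⟨h1, h2, h3, h4⟩ | ⟨h1, h2, h3, h4⟩ | ⟨h1, h2, h3, h4⟩ | ⟨h1, h2, h3, h4⟩ | ⟨h1, h2, h3, h4⟩ | ⟨h1, h2, h3, h4⟩ | ⟨h1, h2, h3, h4⟩ | ⟨h1, h2, h3, h4⟩ | ⟨h1, h2, h3, h4⟩ | ⟨h1, h2, h3, h4⟩ <;> rw [h2, h3, h4]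
  · subst h1; assumption
  · subst h1; assumption
  · subst h1; assumption
  · subst h1; assumption
  · subst h1; assumption
  · subst h1; assumption
  · subst h1; assumption
  · subst h1; assumption
  · subst h1; assumption
  · subst h1; assumption
  · subst h1; assumption
  · subst h1; assumption
  · subst h1; assumption
  · subst h1; assumption
  · rename_i H _ _; exact H i h1.1 h1.2
  · rename_i H _; exact H i h1.1 h1.2
  · subst h1; assumption

lemma tri_adj (s : ℕ → 𝔊) (m a : ℕ) (ha : a + 2 < 14 + 2 * m) (h : mtN m a = a + 2)
    (ht : tN s m a = 1) (g : 𝔊) :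
    (conc s m).graph.Adj (g, ⟨a, by omega⟩) (g, ⟨a + 1, by omega⟩) ∧
    (conc s m).graph.Adj (g, ⟨a + 1, by omega⟩) (g, ⟨a + 2, by omega⟩) ∧
    (conc s m).graph.Adj (g, ⟨a + 2, by omega⟩) (g, ⟨a, by omega⟩) := by
  have h1 := nxN_cases m a (by omega)
  have h2 := nxN_cases m (a + 1) (by omega)
  refine ⟨Or.inl ⟨Fin.ext ?_, rfl⟩, Or.inl ⟨Fin.ext ?_, rfl⟩, SimpleGraph.Adj.symm
    (Or.inr (Or.inr ⟨Fin.ext h.symm, ?_⟩))⟩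
  · change a + 1 = nxN m a
    omega
  · change a + 2 = nxN m (a + 1)
    omega
  · change g = g * tN s m a
    rw [ht, mul_one]

lemma tri_wit (s : ℕ → 𝔊) (m a : ℕ) (ha : a + 2 < 14 + 2 * m) (h : mtN m a = a + 2)
    (ht : tN s m a = 1) (i : Fin (14 + 2 * m)) (hi : a ≤ i ∧ i ≤ a + 2) :
    ∃ j k, ∀ g, (conc s m).graph.Adj (g, i) (g, j) ∧ (conc s m).graph.Adj (g, j) (g, k) ∧
      (conc s m).graph.Adj (g, k) (g, i) := by
  have H := tri_adj s m a ha h ht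
  rcases (by omega : (i : ℕ) = a ∨ (i : ℕ) = a + 1 ∨ (i : ℕ) = a + 2) with h' | h' | h'
  · rw [show i = ⟨a, by omega⟩ from Fin.ext h']
    exact ⟨_, _, H⟩
  · rw [show i = ⟨a + 1, by omega⟩ from Fin.ext h']
    exact ⟨_, _, fun g => ⟨(H g).2.1, (H g).2.2, (H g).1⟩⟩
  · rw [show i = ⟨a + 2, by omega⟩ from Fin.ext h']
    exact ⟨_, _, fun g => ⟨(H g).2.2, (H g).1, (H g).2.1⟩⟩

lemma inv_T (s : ℕ → 𝔊) (m : ℕ) : CInv s m (TT m) := by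
  apply Data.Inv.tri
  · intro i j k h1 h2 h3
    exact tri_base s m i j k h1 h2 h3
  · intro i hi
    have hi' : TT m i := hi
    unfold TT at hi'
    rcases (by omega : ((i : ℕ) ≤ 2) ∨ (3 ≤ (i : ℕ) ∧ (i : ℕ) ≤ 5) ∨
      (10 + m ≤ (i : ℕ) ∧ (i : ℕ) ≤ 12 + m)) with h | h | h
    · exact tri_wit s m 0 (by omega) rfl rfl i (by omega)
    · exact tri_wit s m 3 (by omega) rfl rfl i (by omega)
    · refine tri_wit s m (10 + m) (by omega) ?_ ?_ i (by omega)
      · have := mtN_cases m (10 + m) (by omega)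
        omega
      · unfold tN
        rw [if_neg (by omega), if_neg (by omega), if_pos (by omega)]

lemma inv_start (s : ℕ → 𝔊) (m : ℕ) (hm : 1 ≤ m) :
    (∀ c < 8, CInv s m (· = c)) ∧ CInv s m (· = 13 + 2 * m) := by
  have hT := inv_T s m
  have hA : CInv s m (fun i => i = 2 ∨ i = 3) := by
    refine CInv.congr (hT.and hT.not.nb.not) ?_
    refine elim_cases m hm (C := fun i x y z => ((i < 6 ∨ (10 + m ≤ i ∧ i < 13 + m)) ∧ ¬(¬(x < 6 ∨ (10 + m ≤ x ∧ x < 13 + m)) ∨ ¬(y < 6 ∨ (10 + m ≤ y ∧ y < 13 + m)) ∨ ¬(z < 6 ∨ (10 + m ≤ z ∧ z < 13 + m)))) ↔ (i = 2 ∨ i = 3)) ?_ ?_ ?_ ?_ ?_ ?_ ?_ ?_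
      ?_ ?_ ?_ ?_ ?_ ?_ ?_ ?_ ?_ <;> intros <;> omega
  have hB : CInv s m (fun i => i = 0 ∨ i = 1 ∨ i = 4 ∨ i = 5) := by
    refine CInv.congr (hT.and (hA.not.and hA.nb)) ?_
    refine elim_cases m hm (C := fun i x y z => ((i < 6 ∨ (10 + m ≤ i ∧ i < 13 + m)) ∧ ¬(i = 2 ∨ i = 3) ∧ ((x = 2 ∨ x = 3) ∨ (y = 2 ∨ y = 3) ∨ (z = 2 ∨ z = 3))) ↔ (i = 0 ∨ i = 1 ∨ i = 4 ∨ i = 5)) ?_ ?_ ?_ ?_ ?_ ?_ ?_ ?_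
      ?_ ?_ ?_ ?_ ?_ ?_ ?_ ?_ ?_ <;> intros <;> omega
  have hD : CInv s m (fun i => i = 6 ∨ i = 7 ∨ i = 13 + 2 * m) := by
    refine CInv.congr (hT.not.and hB.nb) ?_
    refine elim_cases m hm (C := fun i x y z => (¬(i < 6 ∨ (10 + m ≤ i ∧ i < 13 + m)) ∧ ((x = 0 ∨ x = 1 ∨ x = 4 ∨ x = 5) ∨ (y = 0 ∨ y = 1 ∨ y = 4 ∨ y = 5) ∨ (z = 0 ∨ z = 1 ∨ z = 4 ∨ z = 5))) ↔ (i = 6 ∨ i = 7 ∨ i = 13 + 2 * m)) ?_ ?_ ?_ ?_ ?_ ?_ ?_ ?_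
      ?_ ?_ ?_ ?_ ?_ ?_ ?_ ?_ ?_ <;> intros <;> omega
  have i7 : CInv s m (fun i => i = 7) := by
    refine CInv.congr (hD.and (hD.nb.and (hT.not.and hD.not).nb)) ?_
    refine elim_cases m hm (C := fun i x y z => ((i = 6 ∨ i = 7 ∨ i = 13 + 2 * m) ∧ ((x = 6 ∨ x = 7 ∨ x = 13 + 2 * m) ∨ (y = 6 ∨ y = 7 ∨ y = 13 + 2 * m) ∨ (z = 6 ∨ z = 7 ∨ z = 13 + 2 * m)) ∧ ((¬(x < 6 ∨ (10 + m ≤ x ∧ x < 13 + m)) ∧ ¬(x = 6 ∨ x = 7 ∨ x = 13 + 2 * m)) ∨ (¬(y < 6 ∨ (10 + m ≤ y ∧ y < 13 + m)) ∧ ¬(y = 6 ∨ y = 7 ∨ y = 13 + 2 * m)) ∨ (¬(z < 6 ∨ (10 + m ≤ z ∧ z < 13 + m)) ∧ ¬(z = 6 ∨ z = 7 ∨ z = 13 + 2 * m)))) ↔ (i = 7)) ?_ ?_ ?_ ?_ ?_ ?_ ?_ ?_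
      ?_ ?_ ?_ ?_ ?_ ?_ ?_ ?_ ?_ <;> intros <;> omega
  have i6 : CInv s m (fun i => i = 6) := by
    refine CInv.congr (hD.and (hD.nb.and i7.not)) ?_
    refine elim_cases m hm (C := fun i x y z => ((i = 6 ∨ i = 7 ∨ i = 13 + 2 * m) ∧ ((x = 6 ∨ x = 7 ∨ x = 13 + 2 * m) ∨ (y = 6 ∨ y = 7 ∨ y = 13 + 2 * m) ∨ (z = 6 ∨ z = 7 ∨ z = 13 + 2 * m)) ∧ ¬ i = 7) ↔ (i = 6)) ?_ ?_ ?_ ?_ ?_ ?_ ?_ ?_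
      ?_ ?_ ?_ ?_ ?_ ?_ ?_ ?_ ?_ <;> intros <;> omega
  have iL : CInv s m (fun i => i = 13 + 2 * m) := by
    refine CInv.congr (hD.and (i6.not.and i7.not)) ?_
    refine elim_cases m hm (C := fun i x y z => ((i = 6 ∨ i = 7 ∨ i = 13 + 2 * m) ∧ ¬ i = 6 ∧ ¬ i = 7) ↔ (i = 13 + 2 * m)) ?_ ?_ ?_ ?_ ?_ ?_ ?_ ?_
      ?_ ?_ ?_ ?_ ?_ ?_ ?_ ?_ ?_ <;> intros <;> omega
  have i4 : CInv s m (fun i => i = 4) := by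
    refine CInv.congr (hB.and i7.nb) ?_
    refine elim_cases m hm (C := fun i x y z => ((i = 0 ∨ i = 1 ∨ i = 4 ∨ i = 5) ∧ (x = 7 ∨ y = 7 ∨ z = 7)) ↔ (i = 4)) ?_ ?_ ?_ ?_ ?_ ?_ ?_ ?_
      ?_ ?_ ?_ ?_ ?_ ?_ ?_ ?_ ?_ <;> intros <;> omega
  have i3 : CInv s m (fun i => i = 3) := by
    refine CInv.congr (hA.and i4.nb) ?_
    refine elim_cases m hm (C := fun i x y z => ((i = 2 ∨ i = 3) ∧ (x = 4 ∨ y = 4 ∨ z = 4)) ↔ (i = 3)) ?_ ?_ ?_ ?_ ?_ ?_ ?_ ?_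
      ?_ ?_ ?_ ?_ ?_ ?_ ?_ ?_ ?_ <;> intros <;> omega
  have i2 : CInv s m (fun i => i = 2) := by
    refine CInv.congr (hA.and i3.not) ?_
    refine elim_cases m hm (C := fun i x y z => ((i = 2 ∨ i = 3) ∧ ¬ i = 3) ↔ (i = 2)) ?_ ?_ ?_ ?_ ?_ ?_ ?_ ?_
      ?_ ?_ ?_ ?_ ?_ ?_ ?_ ?_ ?_ <;> intros <;> omega
  have i5 : CInv s m (fun i => i = 5) := by
    refine CInv.congr (hB.and (i6.nb.and i3.nb)) ?_
    refine elim_cases m hm (C := fun i x y z => ((i = 0 ∨ i = 1 ∨ i = 4 ∨ i = 5) ∧ (x = 6 ∨ y = 6 ∨ z = 6) ∧ (x = 3 ∨ y = 3 ∨ z = 3)) ↔ (i = 5)) ?_ ?_ ?_ ?_ ?_ ?_ ?_ ?_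
      ?_ ?_ ?_ ?_ ?_ ?_ ?_ ?_ ?_ <;> intros <;> omega
  have i1 : CInv s m (fun i => i = 1) := by
    refine CInv.congr (hB.and (i6.nb.and i2.nb)) ?_
    refine elim_cases m hm (C := fun i x y z => ((i = 0 ∨ i = 1 ∨ i = 4 ∨ i = 5) ∧ (x = 6 ∨ y = 6 ∨ z = 6) ∧ (x = 2 ∨ y = 2 ∨ z = 2)) ↔ (i = 1)) ?_ ?_ ?_ ?_ ?_ ?_ ?_ ?_
      ?_ ?_ ?_ ?_ ?_ ?_ ?_ ?_ ?_ <;> intros <;> omega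
  have i0 : CInv s m (fun i => i = 0) := by
    refine CInv.congr (hB.and iL.nb) ?_
    refine elim_cases m hm (C := fun i x y z => ((i = 0 ∨ i = 1 ∨ i = 4 ∨ i = 5) ∧ (x = 13 + 2 * m ∨ y = 13 + 2 * m ∨ z = 13 + 2 * m)) ↔ (i = 0)) ?_ ?_ ?_ ?_ ?_ ?_ ?_ ?_
      ?_ ?_ ?_ ?_ ?_ ?_ ?_ ?_ ?_ <;> intros <;> omega
  refine ⟨?_, iL⟩
  intro c hc
  interval_cases c <;> assumption

lemma inv_rail (s : ℕ → 𝔊) (m : ℕ) (hm : 1 ≤ m) (k : ℕ) (hk : k < m) :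
    CInv s m (· = 7 + k) ∧ CInv s m (· = 8 + k) ∧ CInv s m (· = (if k = 0 then 0 else 14 + 2 * m - k)) ∧
      CInv s m (· = 13 + 2 * m - k) := by
  induction k with
  | zero =>
    obtain ⟨h, hL⟩ := inv_start s m hm
    refine ⟨h 7 (by omega), ?_, h 0 (by omega), hL⟩
    exact CInv.step (8 + 0) (h 7 (by omega)) (h 6 (by omega)) (h 4 (by omega)) (elim_cases m hm
      (C := fun i x y z => i = 8 + 0 ↔ (x = 7 ∨ y = 7 ∨ z = 7) ∧ i ≠ 6 ∧ i ≠ 4)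
      (by omega) (by omega) (by omega) (by omega) (by omega) (by omega) (by omega) (by omega)
      (by omega) (by omega) (by omega) (by omega) (by omega) (by omega)
      (by intros; omega) (by intros; omega) (by omega))
  | succ k ih =>
    obtain ⟨h1, h2, h3, h4⟩ := ih (by omega)
    have h5 : CInv s m (· = 8 + (k + 1)) :=
      CInv.step (8 + (k + 1)) h2 h1 h4 (elim_cases m hm
      (C := fun i x y z => i = 8 + (k + 1) ↔ (x = 8 + k ∨ y = 8 + k ∨ z = 8 + k) ∧ i ≠ 7 + k ∧ i ≠ 13 + 2 * m - k)
      (by omega) (by omega) (by omega) (by omega) (by omega) (by omega) (by omega) (by omega)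
      (by omega) (by omega) (by omega) (by omega) (by omega) (by omega)
      (by intros; omega) (by intros; omega) (by omega))
    have h6 : CInv s m (· = 13 + 2 * m - (k + 1)) := by
      split_ifs at h3 with hk0
      · subst hk0
        exact CInv.step (13 + 2 * m - (0 + 1)) h4 h3 h2 (elim_cases m hm
      (C := fun i x y z => i = 13 + 2 * m - (0 + 1) ↔ (x = 13 + 2 * m - 0 ∨ y = 13 + 2 * m - 0 ∨ z = 13 + 2 * m - 0) ∧ i ≠ 0 ∧ i ≠ 8 + 0)
      (by omega) (by omega) (by omega) (by omega) (by omega) (by omega) (by omega) (by omega)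
      (by omega) (by omega) (by omega) (by omega) (by omega) (by omega)
      (by intros; omega) (by intros; omega) (by omega))
      · exact CInv.step (13 + 2 * m - (k + 1)) h4 h3 h2 (elim_cases m hm
      (C := fun i x y z => i = 13 + 2 * m - (k + 1) ↔ (x = 13 + 2 * m - k ∨ y = 13 + 2 * m - k ∨ z = 13 + 2 * m - k) ∧ i ≠ 14 + 2 * m - k ∧ i ≠ 8 + k)
      (by omega) (by omega) (by omega) (by omega) (by omega) (by omega) (by omega) (by omega)
      (by omega) (by omega) (by omega) (by omega) (by omega) (by omega)
      (by intros; omega) (by intros; omega) (by omega))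
    refine ⟨by rwa [show 7 + (k + 1) = 8 + k by omega], h5, ?_, h6⟩
    rw [if_neg (by omega)]
    have e : 14 + 2 * m - (k + 1) = 13 + 2 * m - k := by omega
    rw [e]
    exact h4

lemma inv_all (s : ℕ → 𝔊) (m : ℕ) (hm : 1 ≤ m) (c : ℕ) (hc : c < 14 + 2 * m) :
    CInv s m (· = c) := by
  obtain ⟨h, hL⟩ := inv_start s m hm
  have up : ∀ c, 7 ≤ c → c < 8 + m → CInv s m (· = c) := by
    intro c h7 h8
    rcases Nat.eq_or_lt_of_le h7 with rfl | h9
    · exact h 7 (by omega)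
    · have := (inv_rail s m hm (c - 8) (by omega)).2.1
      rwa [show 8 + (c - 8) = c by omega] at this
  have dn : ∀ c, 14 + m ≤ c → c < 14 + 2 * m → CInv s m (· = c) := by
    intro c h7 h8
    have := (inv_rail s m hm (13 + 2 * m - c) (by omega)).2.2.2
    rwa [show 13 + 2 * m - (13 + 2 * m - c) = c by omega] at this
  have up1 := up (7 + m) (by omega) (by omega)
  have dn1 := dn (14 + m) (by omega) (by omega)
  have up2 : CInv s m (· = 6 + m) := by
    rcases Nat.eq_or_lt_of_le hm with rfl | h9
    · exact h 7 (by omega)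
    · exact up _ (by omega) (by omega)
  have dn2 : CInv s m (· = if m = 1 then 0 else 15 + m) := by
    split_ifs with h1
    · exact h 0 (by omega)
    · exact dn _ (by omega) (by omega)
  have p0 : CInv s m (· = 8 + m) :=
    CInv.step (8 + m) up1 up2 dn1 (elim_cases m hm
      (C := fun i x y z => i = 8 + m ↔ (x = 7 + m ∨ y = 7 + m ∨ z = 7 + m) ∧ i ≠ 6 + m ∧ i ≠ 14 + m)
      (by omega) (by omega) (by omega) (by omega) (by omega) (by omega) (by omega) (by omega)
      (by omega) (by omega) (by omega) (by omega) (by omega) (by omega)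
      (by intros; omega) (by intros; omega) (by omega))
  have p5 : CInv s m (· = 13 + m) := by
    split_ifs at dn2 with h1
    · exact CInv.step (13 + m) dn1 dn2 up1 (elim_cases m hm
      (C := fun i x y z => i = 13 + m ↔ (x = 14 + m ∨ y = 14 + m ∨ z = 14 + m) ∧ i ≠ 0 ∧ i ≠ 7 + m)
      (by omega) (by omega) (by omega) (by omega) (by omega) (by omega) (by omega) (by omega)
      (by omega) (by omega) (by omega) (by omega) (by omega) (by omega)
      (by intros; omega) (by intros; omega) (by omega))
    · exact CInv.step (13 + m) dn1 dn2 up1 (elim_cases m hm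
      (C := fun i x y z => i = 13 + m ↔ (x = 14 + m ∨ y = 14 + m ∨ z = 14 + m) ∧ i ≠ 15 + m ∧ i ≠ 7 + m)
      (by omega) (by omega) (by omega) (by omega) (by omega) (by omega) (by omega) (by omega)
      (by omega) (by omega) (by omega) (by omega) (by omega) (by omega)
      (by intros; omega) (by intros; omega) (by omega))
  have p1 : CInv s m (fun i => i = 9 + m) := by
    refine CInv.congr (p0.nb.and p5.nb) ?_
    refine elim_cases m hm (C := fun i x y z => ((x = 8 + m ∨ y = 8 + m ∨ z = 8 + m) ∧ (x = 13 + m ∨ y = 13 + m ∨ z = 13 + m)) ↔ (i = 9 + m)) ?_ ?_ ?_ ?_ ?_ ?_ ?_ ?_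
      ?_ ?_ ?_ ?_ ?_ ?_ ?_ ?_ ?_ <;> intros <;> omega
  have p3 : CInv s m (· = 11 + m) :=
    CInv.step (11 + m) p0 up1 p1 (elim_cases m hm
      (C := fun i x y z => i = 11 + m ↔ (x = 8 + m ∨ y = 8 + m ∨ z = 8 + m) ∧ i ≠ 7 + m ∧ i ≠ 9 + m)
      (by omega) (by omega) (by omega) (by omega) (by omega) (by omega) (by omega) (by omega)
      (by omega) (by omega) (by omega) (by omega) (by omega) (by omega)
      (by intros; omega) (by intros; omega) (by omega))
  have p4 : CInv s m (· = 12 + m) :=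
    CInv.step (12 + m) p5 dn1 p1 (elim_cases m hm
      (C := fun i x y z => i = 12 + m ↔ (x = 13 + m ∨ y = 13 + m ∨ z = 13 + m) ∧ i ≠ 14 + m ∧ i ≠ 9 + m)
      (by omega) (by omega) (by omega) (by omega) (by omega) (by omega) (by omega) (by omega)
      (by omega) (by omega) (by omega) (by omega) (by omega) (by omega)
      (by intros; omega) (by intros; omega) (by omega))
  have p2 : CInv s m (· = 10 + m) :=
    CInv.step (10 + m) p1 p0 p5 (elim_cases m hm
      (C := fun i x y z => i = 10 + m ↔ (x = 9 + m ∨ y = 9 + m ∨ z = 9 + m) ∧ i ≠ 8 + m ∧ i ≠ 13 + m)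
      (by omega) (by omega) (by omega) (by omega) (by omega) (by omega) (by omega) (by omega)
      (by omega) (by omega) (by omega) (by omega) (by omega) (by omega)
      (by intros; omega) (by intros; omega) (by omega))
  rcases (by omega : c < 8 ∨ (7 ≤ c ∧ c < 8 + m) ∨ (14 + m ≤ c) ∨ c = 8 + m ∨ c = 9 + m ∨
    c = 10 + m ∨ c = 11 + m ∨ c = 12 + m ∨ c = 13 + m) with
    h' | h' | h' | rfl | rfl | rfl | rfl | rfl | rfl
  · exact h c h'
  · exact up c h'.1 h'.2
  · exact dn c h' hc
  all_goals assumption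

end FruchtCubic

/-- Frucht's theorem for cubic graphs: every finite group is the automorphism group of
some finite connected cubic (3-regular) simple graph. -/
theorem frucht_cubic (𝔊 : Type*) [Group 𝔊] [Finite 𝔊] :
    ∃ (n : ℕ) (G : SimpleGraph (Fin n)),
      G.Connected ∧ G.IsRegularOfDegree 3 ∧ Nonempty (G.autGroup ≃* 𝔊) := by
  obtain ⟨m, ⟨e⟩⟩ := Finite.exists_equiv_fin 𝔊
  have hm : 1 ≤ m := by
    have := (e 1).2
    omega
  let s : ℕ → 𝔊 := fun k => if h : k < m then e.symm ⟨k, h⟩ else 1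
  refine (FruchtCubic.conc s m).main (FruchtCubic.iter_nx s m) ?_ ?_
  · intro x
    refine ⟨⟨8 + e x, by omega⟩, ?_⟩
    change FruchtCubic.tN s m (8 + e x) = x
    unfold FruchtCubic.tN
    rw [if_neg (by omega), if_pos (by omega), show 8 + (e x : ℕ) - 8 = e x by omega]
    simp [s]
  · intro i
    have := FruchtCubic.inv_all s m hm i i.2
    unfold FruchtCubic.CInv at this
    convert this using 1
    ext j
    simp [Fin.ext_iff]
end

section
/- There exists a nut graph of order 7 whose automorphism group is isomorphic to the Klein four-group ℤ₂ × ℤ₂; consequently, since every nut graph has at least 7 vertices, the minimum order of a nut graph realising ℤ₂ × ℤ₂ as its automorphism group is exactly 7. -/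
open scoped Classical

/-! ### Part 1: no nut graph on fewer than seven vertices

A graph is encoded by the list of the rows of its adjacency matrix. An integer vector `y` such
that `A y` has exactly one nonzero entry, or such that `y` is a nonzero kernel vector having a zero
entry, shows that the graph is not a nut graph. -/

namespace NutAux

/-- Product of an integer vector with a `0`-`1` row. -/
def dot : List ℤ → List Bool → ℤ
  | a :: y, b :: r => cond b (a + dot y r) (dot y r)
  | _, _ => 0

/-- Number of ones of a row, i.e. the degree of a vertex. -/
def cnt : List Bool → ℕ
  | [] => 0
  | b :: r => cond b (cnt r + 1) (cnt r)

/-- Number of rows on which `y` does not vanish. -/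
def nz (y : List ℤ) : List (List Bool) → ℕ
  | [] => 0
  | r :: rs => if dot y r = 0 then nz y rs else nz y rs + 1

/-- `y` certifies that the graph is not a nut graph. -/
def test (n : ℕ) (rows : List (List Bool)) (y : List ℤ) : Bool :=
  decide (nz y rows = 1) ||
    (decide (nz y rows = 0) &&
      decide ((∃ i : Fin n, y.getD i 0 = 0) ∧ (∃ i : Fin n, y.getD i 0 ≠ 0)))

def sorted : List ℕ → Bool
  | a :: b :: l => Nat.ble a b && sorted (b :: l)
  | _ => true

/-- Sorting key of a vertex: neighbours of vertex `0` first, then by degree. -/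
def key (b : Bool) (r : List Bool) : ℕ := cond b (1 + cnt r) (10 + cnt r)

/-- Vertex `0` has minimum degree and the other vertices are sorted by key. -/
def canon : List (List Bool) → Bool
  | [] => true
  | r0 :: rest => rest.all (fun r => Nat.ble (cnt r0) (cnt r)) &&
      sorted (List.zipWith key r0.tail rest)

def rows {n : ℕ} (B : Fin n → Fin n → Bool) : List (List Bool) :=
  List.ofFn fun i => List.ofFn fun j => B i j

lemma cnt_ofFn {n : ℕ} (r : Fin n → Bool) : cnt (List.ofFn r) = ∑ i, (r i).toNat := by
  induction n with
  | zero => simp [cnt]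
  | succ n ih =>
    rw [List.ofFn_succ, Fin.sum_univ_succ, cnt, ih]
    cases r 0 <;> simp [add_comm]

lemma dot_ofFn {n : ℕ} (y : List ℤ) (r : Fin n → Bool) :
    dot y (List.ofFn r) = ∑ i : Fin n, if r i then y.getD i 0 else 0 := by
  induction n generalizing y with
  | zero => cases y <;> simp [dot]
  | succ n ih =>
    cases y with
    | nil => simp [dot]
    | cons a y =>
      rw [List.ofFn_succ, Fin.sum_univ_succ, dot, ih]
      cases r 0 <;> simp

lemma nz_ofFn {n : ℕ} (y : List ℤ) (g : Fin n → List Bool) :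
    nz y (List.ofFn g) = ∑ i : Fin n, if dot y (g i) ≠ 0 then 1 else 0 := by
  induction n with
  | zero => simp [nz]
  | succ n ih =>
    rw [List.ofFn_succ, Fin.sum_univ_succ, nz, ih]
    by_cases h : dot y (g 0) = 0 <;> simp [h, add_comm]

/-- The nut property for a Boolean matrix. -/
def BNut {n : ℕ} (B : Fin n → Fin n → Bool) : Prop :=
  (∃ x : Fin n → ℝ, (∀ i, ∑ j, (if B i j then x j else 0) = 0) ∧ ∀ v, x v ≠ 0) ∧
  ∀ x : Fin n → ℝ, (∀ i, ∑ j, (if B i j then x j else 0) = 0) → x ≠ 0 → ∀ v, x v ≠ 0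

lemma sound {n : ℕ} (B : Fin n → Fin n → Bool) (hs : ∀ i j, B i j = B j i) (hB : BNut B)
    (y : List ℤ) : test n (rows B) y = false := by
  obtain ⟨⟨x, hx, hx0⟩, hu⟩ := hB
  by_contra hne
  have ht : test n (rows B) y = true := by simpa using hne
  have hdot : ∀ i, ((dot y (List.ofFn fun j => B i j) : ℤ) : ℝ) =
      ∑ j : Fin n, if B i j then ((y.getD j 0 : ℤ) : ℝ) else 0 := by
    intro i
    rw [dot_ofFn]; push_cast
    rfl
  simp only [test, Bool.or_eq_true, Bool.and_eq_true, decide_eq_true_eq] at ht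
  rw [rows, nz_ofFn, ← Finset.card_filter] at ht
  rcases ht with h1 | ⟨h0, ⟨i, hi⟩, ⟨k, hk⟩⟩
  · obtain ⟨k, hk⟩ := Finset.card_eq_one.mp h1
    have hsum : ∑ i, ((dot y (List.ofFn fun j => B i j) : ℤ) : ℝ) * x i = 0 := by
      simp_rw [hdot, Finset.sum_mul]
      rw [Finset.sum_comm]
      apply Finset.sum_eq_zero
      intro j _
      have := hx j
      calc _ = ((y.getD j 0 : ℤ) : ℝ) * ∑ i, (if B j i then x i else 0) := by
            rw [Finset.mul_sum]
            refine Finset.sum_congr rfl fun i _ => ?_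
            rw [hs i j]
            split_ifs <;> simp
        _ = 0 := by rw [this, mul_zero]
    have hmem : ∀ i, dot y (List.ofFn fun j => B i j) ≠ 0 ↔ i = k := by
      intro i
      have : i ∈ Finset.univ.filter (fun i => dot y (List.ofFn fun j => B i j) ≠ 0) ↔
        i ∈ ({k} : Finset (Fin n)) := by rw [hk]
      simpa using this
    rw [Finset.sum_eq_single k] at hsum
    · rcases mul_eq_zero.mp hsum with h | h
      · exact (hmem k).mpr rfl (by exact_mod_cast h)
      · exact hx0 k h
    · intro i _ hik
      have : dot y (List.ofFn fun j => B i j) = 0 := by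
        by_contra hc; exact hik ((hmem i).mp hc)
      rw [this]; simp
    · simp
  · have hz : ∀ i, dot y (List.ofFn fun j => B i j) = 0 := by
      intro i
      by_contra hc
      have := Finset.card_eq_zero.mp h0
      have h2 : i ∈ Finset.univ.filter (fun i => dot y (List.ofFn fun j => B i j) ≠ 0) := by
        simpa using hc
      rw [this] at h2
      simp at h2
    refine hu (fun j : Fin n => ((y.getD j 0 : ℤ) : ℝ)) ?_ ?_ i ?_
    · intro i
      rw [← hdot, hz]; simp
    · intro h
      have : ((y.getD k 0 : ℤ) : ℝ) = 0 := congrFun h k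
      exact hk (by exact_mod_cast this)
    · exact_mod_cast hi

/-- Every nut graph can be relabelled so that its matrix is in canonical order. -/
lemma exists_canon {m : ℕ} (G : SimpleGraph (Fin (m + 1))) (hG : G.IsNut) :
    ∃ B : Fin (m + 1) → Fin (m + 1) → Bool, BNut B ∧ (∀ i j, B i j = B j i) ∧
      (∀ i, B i i = false) ∧
      (∀ i, cnt (List.ofFn fun j => B 0 j) ≤ cnt (List.ofFn fun j => B i j)) ∧
      (∀ i j, 0 < i → i ≤ j → key (B 0 i) (List.ofFn fun l => B i l) ≤
        key (B 0 j) (List.ofFn fun l => B j l)) := by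
  obtain ⟨-, hfin, huniq⟩ := hG
  set d : Fin (m + 1) → ℕ := fun v => cnt (List.ofFn fun j => decide (G.Adj v j)) with hd
  obtain ⟨v0, hv0⟩ := Finite.exists_min d
  set f : Fin (m + 1) → ℕ := fun v => if v = v0 then 0 else
    key (decide (G.Adj v0 v)) (List.ofFn fun j => decide (G.Adj v j)) with hf
  have hpos : ∀ v, v ≠ v0 → 0 < f v := by
    intro v hv
    simp only [hf, if_neg hv, key]
    cases decide (G.Adj v0 v) <;> simp
  set σ : Equiv.Perm (Fin (m + 1)) := Tuple.sort f with hσ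
  have hmono : Monotone (f ∘ σ) := Tuple.monotone_sort f
  have hσ0 : σ 0 = v0 := by
    by_contra h
    have h1 := hpos _ h
    have h2 : f (σ 0) ≤ f (σ (σ.symm v0)) := hmono (Fin.zero_le _)
    rw [Equiv.apply_symm_apply] at h2
    have h3 : f v0 = 0 := by simp [hf]
    omega
  have hcnt : ∀ i, cnt (List.ofFn fun j => decide (G.Adj (σ i) (σ j))) =
      cnt (List.ofFn fun j => decide (G.Adj (σ i) j)) := by
    intro i
    rw [cnt_ofFn, cnt_ofFn]
    exact Equiv.sum_comp σ (fun j => (decide (G.Adj (σ i) j)).toNat)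
  have hker : ∀ x : Fin (m + 1) → ℝ,
      (∀ i, ∑ j, (if decide (G.Adj (σ i) (σ j)) = true then x j else 0) = 0) ↔
      Matrix.mulVecLin (G.adjMatrix ℝ) (x ∘ σ.symm) = 0 := by
    intro x
    have hrow : ∀ i, ∑ j, (if decide (G.Adj (σ i) (σ j)) = true then x j else 0) =
        Matrix.mulVecLin (G.adjMatrix ℝ) (x ∘ σ.symm) (σ i) := by
      intro i
      rw [Matrix.mulVecLin_apply, Matrix.mulVec, dotProduct]
      refine Eq.trans ?_ (Equiv.sum_comp σ _)
      simp [SimpleGraph.adjMatrix_apply]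
    constructor
    · intro h
      ext v
      have := hrow (σ.symm v)
      rw [h, Equiv.apply_symm_apply] at this
      exact this.symm
    · intro h i
      rw [hrow, h]
      rfl
  refine ⟨fun i j => decide (G.Adj (σ i) (σ j)), ⟨?_, ?_⟩, ?_, ?_, ?_, ?_⟩
  · obtain ⟨⟨w, hw⟩, hw0, -⟩ := finrank_eq_one_iff'.mp hfin
    have hw' : w ≠ 0 := fun h => hw0 (by ext1; simpa using h)
    have hw1 : Matrix.mulVecLin (G.adjMatrix ℝ) w = 0 := by simpa using hw
    refine ⟨w ∘ σ, (hker _).mpr ?_, fun v => huniq w hw1 hw' _⟩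
    have : (w ∘ σ) ∘ σ.symm = w := by ext; simp
    rw [this]; exact hw1
  · intro x hx hx0 v
    have := huniq (x ∘ σ.symm) ((hker x).mp hx) ?_ (σ v)
    · simpa using this
    · intro h
      apply hx0
      ext v
      have := congrFun h (σ v)
      simpa using this
  · intro i j; simp [G.adj_comm]
  · intro i; simp
  · intro i
    have h := hv0 (σ i)
    rw [← hσ0] at h
    simp only [hcnt]
    exact h
  · intro i j hi hij
    have h0 : ∀ i, 0 < i → f (σ i) = key (decide (G.Adj (σ 0) (σ i)))
        (List.ofFn fun l => decide (G.Adj (σ i) (σ l))) := by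
      intro i hi
      have : σ i ≠ v0 := by
        rw [← hσ0]
        exact fun h => hi.ne' (σ.injective h)
      simp only [hf, if_neg this, key, hcnt, hσ0]
    rw [← h0 i hi, ← h0 j (hi.trans_le hij)]
    exact hmono hij

def ys2 : List (List ℤ) := [[0, 1]]

def ys3 : List (List ℤ) := [[0, 0, 1], [1, -1, -1]]

def ys4 : List (List ℤ) := [[1, 0, 0, 0], [1, 0, 0, -1], [1, -2, 1, 1]]

def ys5 : List (List ℤ) := [[1, 0, 0, 0, 0], [1, 0, 0, 0, -1], [0, 0, 1, -1, 0],
  [0, 0, 1, 0, -1], [1, -1, 1, -1, -1], [1, 1, -1, 1, 1], [1, -3, 1, 1, 1]]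

def ys6 : List (List ℤ) := [
  [1, 0, 0, 0, 0, 0], [1, 0, 0, 0, 0, -1], [0, 0, 0, 1, -1, 0], [0, 1, -1, 0, 0, 0],
  [1, 0, 0, -1, 0, 0], [1, 0, 0, 0, -1, 0], [0, 0, 1, 0, -1, 0], [0, 0, 1, -1, 0, 0],
  [0, 0, 1, 0, 0, -1], [0, 0, 0, 0, 1, -1], [0, 0, 0, 1, 0, -1], [0, 1, 0, -1, 0, 0],
  [1, 0, 0, -1, -1, 0], [0, 0, 0, 1, 1, -1], [0, 1, -1, -1, 0, 0], [1, 0, 0, -1, 0, -1],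
  [1, -1, 1, 0, 0, 0], [1, 0, 0, 0, -1, -1], [0, 1, -1, 0, 0, 1], [1, 0, 0, 1, -1, -1],
  [0, 0, 1, -1, -1, 1], [0, 0, 1, -1, 1, -1], [0, 1, -1, 0, -1, 1], [0, 1, -1, 0, 1, -1],
  [0, 1, 0, -1, -1, 1], [0, 1, 0, -1, 1, -1], [1, 1, 1, -2, 1, 1], [1, -2, 2, -1, -1, 1],
  [1, -1, 1, 1, 2, -2], [1, -4, 1, 1, 1, 1], [1, 1, -1, -3, -1, 2], [1, 1, -1, -3, 2, -1],
  [1, 1, -1, -1, -3, 2], [2, 2, -2, 1, 1, 1], [1, 1, -4, 3, 1, 1]]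

lemma comp2 : ∀ a : Bool, canon [[false, a], [a, false]] = true →
    ys2.any (test 2 [[false, a], [a, false]]) = true := by
  decide +kernel

lemma comp3 : ∀ a b c : Bool, canon [[false, a, b], [a, false, c], [b, c, false]] = true →
    ys3.any (test 3 [[false, a, b], [a, false, c], [b, c, false]]) = true := by
  decide +kernel

lemma comp4 : ∀ a b c d e f : Bool,
    canon [[false, a, b, c], [a, false, d, e], [b, d, false, f], [c, e, f, false]] = true →
    ys4.any (test 4
      [[false, a, b, c], [a, false, d, e], [b, d, false, f], [c, e, f, false]]) = true := by
  decide +kernel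

lemma comp5 : ∀ a b c d e f g h i j : Bool,
    canon [[false, a, b, c, d], [a, false, e, f, g], [b, e, false, h, i], [c, f, h, false, j],
      [d, g, i, j, false]] = true →
    ys5.any (test 5 [[false, a, b, c, d], [a, false, e, f, g], [b, e, false, h, i],
      [c, f, h, false, j], [d, g, i, j, false]]) = true := by
  decide +kernel

lemma comp6 : ∀ a b : Bool, (b = true → a = true) → ∀ c : Bool, (c = true → b = true) →
    ∀ d : Bool, (d = true → c = true) → ∀ e : Bool, (e = true → d = true) →
    ∀ f g h i j k l m n o : Bool,
    canon [[false, a, b, c, d, e], [a, false, f, g, h, i], [b, f, false, j, k, l],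
      [c, g, j, false, m, n], [d, h, k, m, false, o], [e, i, l, n, o, false]] = true →
    ys6.any (test 6 [[false, a, b, c, d, e], [a, false, f, g, h, i], [b, f, false, j, k, l],
      [c, g, j, false, m, n], [d, h, k, m, false, o], [e, i, l, n, o, false]]) = true := by
  decide +kernel

lemma key_imp (b c : Bool) (r s : List Bool) (h : key b r ≤ key c s) (hs : cnt s ≤ 6) :
    c = true → b = true := by
  rintro rfl
  cases b
  · simp [key] at h; omega
  · rfl

lemma cnt_le {n : ℕ} (r : Fin n → Bool) : cnt (List.ofFn r) ≤ n := by
  rw [cnt_ofFn]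
  calc _ ≤ ∑ _i : Fin n, 1 := Finset.sum_le_sum fun i _ => Bool.toNat_le _
    _ = n := by simp

lemma any_false {n : ℕ} (B : Fin n → Fin n → Bool) (hs : ∀ i j, B i j = B j i) (hB : BNut B)
    (ys : List (List ℤ)) (h : ys.any (test n (rows B)) = true) : False := by
  obtain ⟨y, -, hy⟩ := List.any_eq_true.mp h
  rw [sound B hs hB y] at hy
  exact Bool.false_ne_true hy

lemma canon_rows {m : ℕ} (B : Fin (m + 1) → Fin (m + 1) → Bool)
    (hm : ∀ i, cnt (List.ofFn fun j => B 0 j) ≤ cnt (List.ofFn fun j => B i j))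
    (hk : ∀ i j, 0 < i → i ≤ j → key (B 0 i) (List.ofFn fun l => B i l) ≤
        key (B 0 j) (List.ofFn fun l => B j l)) : canon (rows B) = true := by
  have hz : ∀ {k : ℕ} (u : Fin k → Bool) (v : Fin k → List Bool),
      List.zipWith key (List.ofFn u) (List.ofFn v) = List.ofFn fun i => key (u i) (v i) := by
    intro k u v
    induction k with
    | zero => simp
    | succ k ih => simp [List.ofFn_succ, ih]
  have hsorted : ∀ {k : ℕ} (u : Fin k → ℕ), Monotone u → sorted (List.ofFn u) = true := by
    intro k u hu
    induction k with
    | zero => simp [sorted]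
    | succ k ih =>
      cases k with
      | zero => simp [sorted]
      | succ k =>
        have h1 := ih (fun i => u i.succ) (fun a b hab => hu (Fin.succ_le_succ_iff.mpr hab))
        rw [List.ofFn_succ] at h1 ⊢
        rw [List.ofFn_succ, sorted, h1]
        simpa using hu (Fin.zero_le _)
  rw [rows, List.ofFn_succ, canon, Bool.and_eq_true]
  constructor
  · rw [List.all_eq_true]
    intro r hr
    obtain ⟨i, rfl⟩ := (List.mem_ofFn' _ _).mp hr
    exact Nat.ble_eq.mpr (hm _)
  · rw [List.ofFn_succ (f := fun j => B 0 j), List.tail_cons, hz]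
    apply hsorted
    intro a b hab
    exact hk _ _ (Fin.succ_pos _) (Fin.succ_le_succ_iff.mpr hab)

lemma not_nut {n : ℕ} (hn : n < 7) (G : SimpleGraph (Fin n)) : ¬ G.IsNut := by
  intro hG
  have h2 : 2 ≤ n := by simpa using hG.1
  obtain ⟨m, rfl⟩ : ∃ m, n = m + 1 := ⟨n - 1, by omega⟩
  obtain ⟨B, hB, hs, hd, hm, hk⟩ := exists_canon G hG
  have hc := canon_rows B hm hk
  have hi : ∀ i j, 0 < i → i ≤ j → B 0 j = true → B 0 i = true := fun i j h1 h2 =>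
    key_imp _ _ _ _ (hk i j h1 h2) ((cnt_le _).trans (by omega))
  obtain rfl | rfl | rfl | rfl | rfl : m = 1 ∨ m = 2 ∨ m = 3 ∨ m = 4 ∨ m = 5 := by omega
  · have hr : rows B = [[false, B 0 1], [B 0 1, false]] := by
      simp [rows, List.ofFn_succ, hd, hs 1 0]
    refine any_false B hs hB ys2 ?_
    rw [hr] at hc ⊢
    exact comp2 _ hc
  · have hr : rows B = [[false, B 0 1, B 0 2], [B 0 1, false, B 1 2], [B 0 2, B 1 2, false]] := by
      simp [rows, List.ofFn_succ, hd, hs 1 0, hs 2 0, hs 2 1]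
    refine any_false B hs hB ys3 ?_
    rw [hr] at hc ⊢
    exact comp3 _ _ _ hc
  · have hr : rows B = [[false, B 0 1, B 0 2, B 0 3], [B 0 1, false, B 1 2, B 1 3],
        [B 0 2, B 1 2, false, B 2 3], [B 0 3, B 1 3, B 2 3, false]] := by
      simp [rows, List.ofFn_succ, hd, hs 1 0, hs 2 0, hs 2 1, hs 3 0, hs 3 1, hs 3 2]
    refine any_false B hs hB ys4 ?_
    rw [hr] at hc ⊢
    exact comp4 _ _ _ _ _ _ hc
  · have hr : rows B = [[false, B 0 1, B 0 2, B 0 3, B 0 4],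
        [B 0 1, false, B 1 2, B 1 3, B 1 4], [B 0 2, B 1 2, false, B 2 3, B 2 4],
        [B 0 3, B 1 3, B 2 3, false, B 3 4], [B 0 4, B 1 4, B 2 4, B 3 4, false]] := by
      simp [rows, List.ofFn_succ, hd, hs 1 0, hs 2 0, hs 2 1, hs 3 0, hs 3 1, hs 3 2,
        hs 4 0, hs 4 1, hs 4 2, hs 4 3]
    refine any_false B hs hB ys5 ?_
    rw [hr] at hc ⊢
    exact comp5 _ _ _ _ _ _ _ _ _ _ hc
  · have hr : rows B = [[false, B 0 1, B 0 2, B 0 3, B 0 4, B 0 5],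
        [B 0 1, false, B 1 2, B 1 3, B 1 4, B 1 5], [B 0 2, B 1 2, false, B 2 3, B 2 4, B 2 5],
        [B 0 3, B 1 3, B 2 3, false, B 3 4, B 3 5], [B 0 4, B 1 4, B 2 4, B 3 4, false, B 4 5],
        [B 0 5, B 1 5, B 2 5, B 3 5, B 4 5, false]] := by
      simp [rows, List.ofFn_succ, hd, hs 1 0, hs 2 0, hs 2 1, hs 3 0, hs 3 1, hs 3 2,
        hs 4 0, hs 4 1, hs 4 2, hs 4 3, hs 5 0, hs 5 1, hs 5 2, hs 5 3, hs 5 4]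
    refine any_false B hs hB ys6 ?_
    rw [hr] at hc ⊢
    exact comp6 _ _ (hi 1 2 (by decide) (by decide)) _ (hi 2 3 (by decide) (by decide))
      _ (hi 3 4 (by decide) (by decide)) _ (hi 4 5 (by decide) (by decide))
      _ _ _ _ _ _ _ _ _ _ hc

/-! ### Part 2: a nut graph on seven vertices with Klein four-group symmetry -/

/-- Adjacency of the graph with edges 02, 06, 13, 15, 23, 34, 35, 46. -/
def adj7 : Fin 7 → Fin 7 → Bool :=
  ![![false, false, true, false, false, false, true],
    ![false, false, false, true, false, true, false],
    ![true, false, false, true, false, false, false],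
    ![false, true, true, false, true, true, false],
    ![false, false, false, true, false, false, true],
    ![false, true, false, true, false, false, false],
    ![true, false, false, false, true, false, false]]

def G7 : SimpleGraph (Fin 7) where
  Adj i j := adj7 i j = true
  symm := ⟨by decide⟩
  loopless := ⟨by decide⟩

lemma ker7 (x : Fin 7 → ℝ) : Matrix.mulVecLin (G7.adjMatrix ℝ) x = 0 ↔
    x = x 0 • ![1, 1, -1, -1, -1, 1, 1] := by
  have key : Matrix.mulVecLin (G7.adjMatrix ℝ) x =
      ![x 2 + x 6, x 3 + x 5, x 0 + x 3, x 1 + x 2 + x 4 + x 5, x 3 + x 6, x 1 + x 3,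
        x 0 + x 4] := by
    ext i
    rw [Matrix.mulVecLin_apply, Matrix.mulVec, dotProduct]
    fin_cases i <;>
      simp [Fin.sum_univ_succ, SimpleGraph.adjMatrix_apply, G7, adj7, add_assoc]
  rw [key]
  constructor
  · intro h
    have h0 := congrFun h 0
    have h1 := congrFun h 1
    have h2 := congrFun h 2
    have h4 := congrFun h 4
    have h5 := congrFun h 5
    have h6 := congrFun h 6
    simp at h0 h1 h2 h4 h5 h6
    ext i
    fin_cases i <;> simp <;> linarith
  · intro h
    have h1 := congrFun h 1
    have h2 := congrFun h 2
    have h3 := congrFun h 3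
    have h4 := congrFun h 4
    have h5 := congrFun h 5
    have h6 := congrFun h 6
    simp at h1 h2 h3 h4 h5 h6
    ext i
    fin_cases i <;> simp <;> linarith

lemma nut7 : G7.IsNut := by
  refine ⟨by simp, ?_, ?_⟩
  · rw [finrank_eq_one_iff']
    refine ⟨⟨![1, 1, -1, -1, -1, 1, 1], ?_⟩, ?_, ?_⟩
    · rw [LinearMap.mem_ker, ker7]; simp
    · intro h
      have := congrFun (congrArg Subtype.val h) 0
      simp at this
    · rintro ⟨w, hw⟩
      rw [LinearMap.mem_ker, ker7] at hw
      exact ⟨w 0, Subtype.ext hw.symm⟩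
  · intro x hx hx0 v
    rw [ker7] at hx
    have h0 : x 0 ≠ 0 := by
      intro h
      rw [h, zero_smul] at hx
      exact hx0 hx
    rw [hx]
    fin_cases v <;> simpa using h0

set_option synthInstance.maxHeartbeats 400000 in
set_option synthInstance.maxSize 4000 in
lemma aut_values : ∀ d : Fin 7, ∀ b : Fin 7, adj7 b d = true →
    ∀ f : Fin 7, adj7 f d = true → adj7 b f = true →
    ∀ c : Fin 7, adj7 c d = true → adj7 c b = false → adj7 c f = false → c ≠ b → c ≠ f →
    ∀ e : Fin 7, adj7 e d = true → adj7 e b = false → adj7 e f = false → e ≠ c → e ≠ b → e ≠ f →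
    ∀ a : Fin 7, adj7 a c = true → a ≠ d → ∀ g : Fin 7, adj7 g e = true → g ≠ d →
    adj7 a g = true →
    (a = 0 ∧ b = 1 ∧ c = 2 ∧ d = 3 ∧ e = 4 ∧ f = 5 ∧ g = 6) ∨
    (a = 0 ∧ b = 5 ∧ c = 2 ∧ d = 3 ∧ e = 4 ∧ f = 1 ∧ g = 6) ∨
    (a = 6 ∧ b = 1 ∧ c = 4 ∧ d = 3 ∧ e = 2 ∧ f = 5 ∧ g = 0) ∨
    (a = 6 ∧ b = 5 ∧ c = 4 ∧ d = 3 ∧ e = 2 ∧ f = 1 ∧ g = 0) := by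
  decide +kernel

/-- The four automorphisms. -/
def s7 : Equiv.Perm (Fin 7) := Equiv.swap 1 5

def t7 : Equiv.Perm (Fin 7) := Equiv.swap 0 6 * Equiv.swap 2 4

lemma aut_mem (σ : Equiv.Perm (Fin 7)) :
    σ ∈ G7.autGroup ↔ σ ∈ ({1, s7, t7, s7 * t7} : Finset (Equiv.Perm (Fin 7))) := by
  simp only [Finset.mem_insert, Finset.mem_singleton]
  constructor
  · intro h
    have h1 : ∀ u v : Fin 7, adj7 (σ u) (σ v) = adj7 u v := by
      intro u v
      have := h u v
      change (adj7 (σ u) (σ v) = true ↔ adj7 u v = true) at this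
      exact Bool.eq_iff_iff.mpr this
    have hn : ∀ u v : Fin 7, u ≠ v → σ u ≠ σ v := fun u v huv h => huv (σ.injective h)
    have hv := aut_values (σ 3) (σ 1) (h1 _ _) (σ 5) (h1 _ _) (h1 _ _) (σ 2) (h1 _ _) (h1 _ _)
      (h1 _ _) (hn _ _ (by decide)) (hn _ _ (by decide)) (σ 4) (h1 _ _) (h1 _ _) (h1 _ _)
      (hn _ _ (by decide)) (hn _ _ (by decide)) (hn _ _ (by decide)) (σ 0) (h1 _ _)
      (hn _ _ (by decide)) (σ 6) (h1 _ _) (hn _ _ (by decide)) (h1 _ _)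
    rcases hv with ⟨h0, h1, h2, h3, h4, h5, h6⟩ | ⟨h0, h1, h2, h3, h4, h5, h6⟩ |
      ⟨h0, h1, h2, h3, h4, h5, h6⟩ | ⟨h0, h1, h2, h3, h4, h5, h6⟩
    · left
      ext i; fin_cases i <;> simp [*]
    · right; left
      ext i; fin_cases i <;> simp [*] <;> decide
    · right; right; left
      ext i; fin_cases i <;> simp [*] <;> decide
    · right; right; right
      ext i; fin_cases i <;> simp [*] <;> decide
  · intro h
    change ∀ u v, adj7 (σ u) (σ v) = true ↔ adj7 u v = true
    rcases h with rfl | rfl | rfl | rfl <;> decide +kernel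

lemma klein7 : IsKleinFour G7.autGroup where
  card_four := by
    have : (G7.autGroup : Set (Equiv.Perm (Fin 7))) =
        (({1, s7, t7, s7 * t7} : Finset (Equiv.Perm (Fin 7))) : Set (Equiv.Perm (Fin 7))) := by
      ext σ; exact aut_mem σ
    change Nat.card (G7.autGroup : Set (Equiv.Perm (Fin 7))) = 4
    rw [this, Nat.card_coe_set_eq, Set.ncard_coe_finset]
    decide +kernel
  exponent_two := by
    have hmem : s7 ∈ G7.autGroup := (aut_mem _).mpr (by simp)
    have hne : s7 ≠ 1 := by decide
    have hnt : Nontrivial G7.autGroup :=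
      ⟨⟨⟨s7, hmem⟩, 1, fun h => hne (congrArg Subtype.val h)⟩⟩
    rw [Monoid.exponent_eq_prime_iff Nat.prime_two]
    rintro ⟨σ, hσ⟩ hσ1
    refine orderOf_eq_prime ?_ hσ1
    have h2 := (aut_mem σ).mp hσ
    apply Subtype.ext
    change σ ^ 2 = 1
    simp only [Finset.mem_insert, Finset.mem_singleton] at h2
    rcases h2 with rfl | rfl | rfl | rfl <;> decide +kernel

end NutAux

/-- There is a nut graph of order 7 whose automorphism group is the Klein four-group
`ℤ₂ × ℤ₂`; consequently (since every nut graph has at least 7 vertices), `7` is the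
minimum order of a nut graph realising `ℤ₂ × ℤ₂` as its automorphism group. -/
theorem klein_four_nut_graph_min_order :
    (∃ G : SimpleGraph (Fin 7), G.IsNut ∧
        Nonempty (G.autGroup ≃* Multiplicative (ZMod 2 × ZMod 2))) ∧
    IsLeast {n : ℕ | ∃ G : SimpleGraph (Fin n), G.IsNut ∧
        Nonempty (G.autGroup ≃* Multiplicative (ZMod 2 × ZMod 2))} 7 := by
  have h7 : ∃ G : SimpleGraph (Fin 7), G.IsNut ∧
      Nonempty (G.autGroup ≃* Multiplicative (ZMod 2 × ZMod 2)) := by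
    have := NutAux.klein7
    exact ⟨NutAux.G7, NutAux.nut7, IsKleinFour.nonempty_mulEquiv⟩
  refine ⟨h7, h7, ?_⟩
  rintro n ⟨G, hG, -⟩
  by_contra hn
  exact NutAux.not_nut (by omega) G hG
end
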